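/- Gromov's removable singularity theorem (local version in ℂⁿ): Let ω be a nondegenerate alternating real bilinear form on ℂⁿ ≅ ℝ^{2n}, and let J be an almost complex structure on ℂⁿ tamed by ω, i.e. ω(v, J(x)v) > 0 for every x ∈ ℂⁿ and every v ≠ 0. Suppose u : B \ {0} → ℂⁿ is a smooth J-holomorphic curve on the punctured open unit ball whose image is contained in a compact subset of ℂⁿ and which has finite energy, i.e. ∫_{B\{0}} ω(∂ₛu(z), ∂ₜu(z)) dλ(z) < ∞ with respect to Lebesgue measure λ on ℂ (the integrand is nonnegative by tameness). Then u extends smoothly over 0 to a J-holomorphic curve on B: there is a smooth map ũ : B → ℂⁿ with ∂ₛũ + J(ũ)∂ₜũ = 0 on B and ũ = u on B \ {0}. -/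

import Mathlib

open Metric Complex MeasureTheory

namespace PseudoHol

open Set Filter Topology
open scoped Real

/-- Differentiation under an interval integral whose integrand is `C¹` in the parameter. -/
theorem hasDerivAt_intervalIntegral {E : Type*} [NormedAddCommGroup E] [NormedSpace ℝ E]
    {U : Set ℝ} (hU : IsOpen U) {g g' : ℝ → ℝ → E}
    (hd : ∀ s ∈ U, ∀ t, HasDerivAt (fun s => g s t) (g' s t) s)
    (hg : ∀ s ∈ U, Continuous (g s))
    (hg' : ContinuousOn (fun p : ℝ × ℝ => g' p.1 p.2) (U ×ˢ univ))
    {s₀ : ℝ} (h₀ : s₀ ∈ U) (a b : ℝ) :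
    HasDerivAt (fun s => ∫ t in a..b, g s t) (∫ t in a..b, g' s₀ t) s₀ := by
  obtain ⟨ε, hε, hsub⟩ := Metric.nhds_basis_closedBall.mem_iff.1 (hU.mem_nhds h₀)
  have hK : IsCompact (closedBall s₀ ε ×ˢ uIcc a b) :=
    (isCompact_closedBall _ _).prod isCompact_uIcc
  obtain ⟨C, hC⟩ := hK.exists_bound_of_continuousOn
    (hg'.mono (prod_mono hsub (subset_univ _)))
  have hgc : ∀ s ∈ U, Continuous (g' s) := fun s hs =>
    hg'.comp_continuous (by fun_prop : Continuous fun t : ℝ => (s, t)) fun t => ⟨hs, mem_univ _⟩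
  refine (intervalIntegral.hasDerivAt_integral_of_dominated_loc_of_deriv_le
    (bound := fun _ => C) (closedBall_mem_nhds s₀ hε) ?_ ((hg _ h₀).intervalIntegrable _ _)
    (hgc _ h₀).aestronglyMeasurable ?_ intervalIntegrable_const ?_).2
  · filter_upwards [hU.mem_nhds h₀] with s hs using (hg s hs).aestronglyMeasurable
  · exact .of_forall fun t ht s hs => hC (s, t) ⟨hs, uIoc_subset_uIcc ht⟩
  · exact .of_forall fun t _ s hs => hd s (hsub hs) t

/-- **Wirtinger's inequality** for scalar functions. -/
theorem wirtinger_real {f f' : ℝ → ℝ} (hf : ∀ t, HasDerivAt f (f' t) t)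
    (hf' : Continuous f') (hper : f (2 * π) = f 0) (hmean : ∫ t in (0)..(2 * π), f t = 0) :
    ∫ t in (0)..(2 * π), f t ^ 2 ≤ ∫ t in (0)..(2 * π), f' t ^ 2 := by
  have hpi : (0 : ℝ) < 2 * π := by positivity
  have hfc : Continuous f := continuous_iff_continuousAt.2 fun t => (hf t).continuousAt
  have hL2 : ∀ g : ℝ → ℝ, Continuous g →
      MemLp (fun t => (g t : ℂ)) 2 (volume.restrict (Ioc 0 (2 * π))) := by
    intro g hg
    have hc : Continuous fun t => (g t : ℂ) := Complex.continuous_ofReal.comp hg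
    obtain ⟨C, hC⟩ := (isCompact_Icc (a := 0) (b := 2 * π)).exists_bound_of_continuousOn
      hc.continuousOn
    exact MemLp.of_bound hc.aestronglyMeasurable C ((ae_restrict_iff' measurableSet_Ioc).2
      (.of_forall fun t ht => hC t (Ioc_subset_Icc_self ht)))
  have h1 := hasSum_sq_fourierCoeffOn hpi (hL2 f hfc)
  have h2 := hasSum_sq_fourierCoeffOn hpi (hL2 f' hf')
  have key : ∀ n : ℤ, ‖fourierCoeffOn hpi (fun t => (f t : ℂ)) n‖ ^ 2 ≤
      ‖fourierCoeffOn hpi (fun t => (f' t : ℂ)) n‖ ^ 2 := by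
    intro n
    by_cases hn : n = 0
    · subst hn
      have : fourierCoeffOn hpi (fun t => (f t : ℂ)) 0 = 0 := by
        rw [fourierCoeffOn_eq_integral]
        simp only [neg_zero, fourier_zero, one_smul]
        rw [intervalIntegral.integral_ofReal, hmean]; simp
      rw [this]; simp
    · have := fourierCoeffOn_of_hasDerivAt hpi (f := fun t => (f t : ℂ))
        (f' := fun t => (f' t : ℂ)) hn (fun x _ => (hf x).ofReal_comp)
        ((Complex.continuous_ofReal.comp hf').intervalIntegrable _ _)
      rw [this]
      simp only [hper, sub_self, mul_zero, zero_sub]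
      gcongr
      rw [norm_mul, norm_neg, norm_mul]
      have hn1 : (1 : ℝ) ≤ |(n : ℝ)| := by
        rw [← Int.cast_abs]; exact_mod_cast Int.one_le_abs hn
      have e1 : ‖(1 : ℂ) / (-2 * π * I * n)‖ = 1 / (2 * π * |(n : ℝ)|) := by
        simp [abs_of_pos Real.pi_pos]
      have e2 : ‖(((2 * π : ℝ) : ℂ) - ((0 : ℝ) : ℂ))‖ = 2 * π := by
        simp [abs_of_pos Real.pi_pos]
      rw [e1, e2, ← mul_assoc]
      have : 1 / (2 * π * |(n : ℝ)|) * (2 * π) ≤ 1 := by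
        rw [div_mul_eq_mul_div, one_mul, div_le_one (by positivity)]
        nlinarith
      exact mul_le_of_le_one_left (norm_nonneg _) this
  have h3 := hasSum_le key h1 h2
  simp only [sub_zero, smul_eq_mul, Complex.norm_real, Real.norm_eq_abs, sq_abs] at h3
  exact le_of_mul_le_mul_left h3 (by positivity)

/-- **Wirtinger's inequality** in a finite-dimensional inner product space. -/
theorem wirtinger {X : Type*} [NormedAddCommGroup X] [InnerProductSpace ℝ X]
    [FiniteDimensional ℝ X] {f f' : ℝ → X} (hf : ∀ t, HasDerivAt f (f' t) t)
    (hf' : Continuous f') (hper : f (2 * π) = f 0) (hmean : ∫ t in (0)..(2 * π), f t = 0) :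
    ∫ t in (0)..(2 * π), ‖f t‖ ^ 2 ≤ ∫ t in (0)..(2 * π), ‖f' t‖ ^ 2 := by
  have hfc : Continuous f := continuous_iff_continuousAt.2 fun t => (hf t).continuousAt
  let b := stdOrthonormalBasis ℝ X
  have hn : ∀ x : X, ‖x‖ ^ 2 = ∑ i, (inner ℝ (b i) x) ^ 2 := by
    intro x
    rw [← b.sum_sq_norm_inner_right x]
    simp
  simp_rw [hn]
  rw [intervalIntegral.integral_finsetSum, intervalIntegral.integral_finsetSum]
  · refine Finset.sum_le_sum fun i _ => ?_
    refine wirtinger_real (f := fun t => inner ℝ (b i) (f t)) (f' := fun t => inner ℝ (b i) (f' t))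
      (fun t => ?_) (by fun_prop) (by simp [hper]) ?_
    · exact ((innerSL ℝ (b i)).hasFDerivAt.comp_hasDerivAt t (hf t))
    · have := (innerSL ℝ (b i)).intervalIntegral_comp_comm (μ := volume) (a := 0) (b := 2 * π)
        (hfc.intervalIntegrable _ _)
      simp only [innerSL_apply_apply] at this
      rw [this, hmean]; simp
  · intro i _
    exact Continuous.intervalIntegrable (by fun_prop) _ _
  · intro i _
    exact Continuous.intervalIntegrable (by fun_prop) _ _

/-- Isoperimetric inequality: the action of a loop is bounded by the `L²` norm of its velocity. -/
theorem abs_action_le {V X : Type*} [NormedAddCommGroup V] [NormedSpace ℝ V] [CompleteSpace V]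
    [NormedAddCommGroup X] [InnerProductSpace ℝ X] [FiniteDimensional ℝ X]
    (T : V →L[ℝ] X) (ω : V →L[ℝ] V →L[ℝ] ℝ) {M : ℝ} (hM : 0 ≤ M)
    (hω : ∀ a b, |ω a b| ≤ M * (‖T a‖ * ‖T b‖))
    {f f' : ℝ → V} (hf : ∀ t, HasDerivAt f (f' t) t) (hf' : Continuous f')
    (hper : f (2 * π) = f 0) :
    |∫ t in (0)..(2 * π), ω (f t) (f' t)| ≤ M * ∫ t in (0)..(2 * π), ‖T (f' t)‖ ^ 2 := by
  have hfc : Continuous f := continuous_iff_continuousAt.2 fun t => (hf t).continuousAt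
  set m : V := (2 * π)⁻¹ • ∫ t in (0)..(2 * π), f t with hm
  have hpi : (0 : ℝ) < 2 * π := by positivity
  have hint : ∫ t in (0)..(2 * π), f' t = 0 := by
    rw [intervalIntegral.integral_eq_sub_of_hasDerivAt (fun t _ => hf t)
      (hf'.intervalIntegrable _ _), hper, sub_self]
  have e1 : ∫ t in (0)..(2 * π), ω (f t) (f' t) = ∫ t in (0)..(2 * π), ω (f t - m) (f' t) := by
    have : ∫ t in (0)..(2 * π), ω m (f' t) = 0 := by
      rw [(ω m).intervalIntegral_comp_comm (hf'.intervalIntegrable _ _), hint, map_zero]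
    simp only [map_sub, _root_.sub_apply]
    rw [intervalIntegral.integral_sub, this, sub_zero]
    · exact Continuous.intervalIntegrable (by fun_prop) _ _
    · exact Continuous.intervalIntegrable (by fun_prop) _ _
  have hW : ∫ t in (0)..(2 * π), ‖T (f t - m)‖ ^ 2 ≤ ∫ t in (0)..(2 * π), ‖T (f' t)‖ ^ 2 := by
    refine wirtinger (f := fun t => T (f t - m)) (f' := fun t => T (f' t))
      (fun t => T.hasFDerivAt.comp_hasDerivAt t ((hf t).sub_const m)) (by fun_prop)
      (by simp [hper]) ?_
    rw [T.intervalIntegral_comp_comm (Continuous.intervalIntegrable (by fun_prop) _ _),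
      intervalIntegral.integral_sub (hfc.intervalIntegrable _ _) intervalIntegrable_const,
      intervalIntegral.integral_const, hm, smul_smul, sub_zero, mul_inv_cancel₀ hpi.ne', one_smul,
      sub_self, map_zero]
  rw [e1]
  have b1 : |∫ t in (0)..(2 * π), ω (f t - m) (f' t)| ≤
      ∫ t in (0)..(2 * π), M * ((‖T (f t - m)‖ ^ 2 + ‖T (f' t)‖ ^ 2) / 2) := by
    refine (intervalIntegral.abs_integral_le_integral_abs hpi.le).trans ?_
    refine intervalIntegral.integral_mono_on hpi.le
      (Continuous.intervalIntegrable (by fun_prop) _ _)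
      (Continuous.intervalIntegrable (by fun_prop) _ _) fun t _ => (hω _ _).trans ?_
    gcongr
    nlinarith [sq_nonneg (‖T (f t - m)‖ - ‖T (f' t)‖)]
  refine b1.trans ?_
  rw [intervalIntegral.integral_const_mul, intervalIntegral.integral_div,
    intervalIntegral.integral_add (Continuous.intervalIntegrable (by fun_prop) _ _)
      (Continuous.intervalIntegrable (by fun_prop) _ _)]
  gcongr
  linarith

/-- A function whose square is controlled by its derivative near `-∞` is nonnegative. -/
theorem nonneg_of_sq_le_deriv {a a' : ℝ → ℝ} {C : ℝ} (hC : 0 < C)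
    (ha : ∀ s < 0, HasDerivAt a (a' s) s) (h : ∀ s < 0, a s ^ 2 ≤ C * a' s) :
    ∀ s < 0, 0 ≤ a s := by
  intro s₀ hs₀
  by_contra! hneg
  have ha' : ∀ s < 0, 0 ≤ a' s := fun s hs =>
    nonneg_of_mul_nonneg_right ((sq_nonneg _).trans (h s hs)) hC
  have hmono : MonotoneOn a (Iic s₀) := by
    refine monotoneOn_of_deriv_nonneg (convex_Iic _)
      (fun s hs => (ha s (lt_of_le_of_lt hs hs₀)).continuousAt.continuousWithinAt)
      (fun s hs => ?_) (fun s hs => ?_)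
    all_goals rw [interior_Iic] at hs
    · exact (ha s (lt_trans hs hs₀)).differentiableAt.differentiableWithinAt
    · rw [(ha s (lt_trans hs hs₀)).deriv]; exact ha' s (lt_trans hs hs₀)
  have hlt : ∀ s ≤ s₀, a s < 0 := fun s hs => (hmono hs (mem_Iic.2 le_rfl) hs).trans_lt hneg
  have hder : ∀ s ≤ s₀, HasDerivAt (fun s => -(a s)⁻¹ - s / C) (a' s / a s ^ 2 - 1 / C) s := by
    intro s hs
    convert! ((ha s (hs.trans_lt hs₀)).inv (hlt s hs).ne).neg.sub ((hasDerivAt_id s).div_const C) using 1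
    ring
  have hmono2 : MonotoneOn (fun s => -(a s)⁻¹ - s / C) (Iic s₀) := by
    refine monotoneOn_of_deriv_nonneg (convex_Iic _)
      (fun s hs => (hder s hs).continuousAt.continuousWithinAt)
      (fun s hs => ?_) (fun s hs => ?_)
    all_goals rw [interior_Iic] at hs
    · exact (hder s hs.le).differentiableAt.differentiableWithinAt
    · rw [(hder s hs.le).deriv, sub_nonneg, div_le_div_iff₀ hC (sq_pos_of_neg (hlt s hs.le))]
      linarith [h s (lt_trans hs hs₀)]
  set D := -(a s₀)⁻¹ with hD
  have hDpos : 0 < D := by rw [hD, neg_pos]; exact inv_lt_zero.2 hneg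
  have hle : s₀ - C * D ≤ s₀ := sub_le_self _ (by positivity)
  have h1 := hmono2 (mem_Iic.2 hle) (mem_Iic.2 le_rfl) hle
  have h2 : 0 < -(a (s₀ - C * D))⁻¹ := by
    rw [neg_pos]; exact inv_lt_zero.2 (hlt _ hle)
  simp only at h1
  have h3 : (s₀ - C * D) / C = s₀ / C - D := by field_simp
  rw [h3] at h1
  linarith

/-- Grönwall's inequality towards `-∞`. -/
theorem le_exp_of_deriv_ge {a a' κ κ' : ℝ → ℝ} {s₁ : ℝ}
    (ha : ∀ s ≤ s₁, HasDerivAt a (a' s) s) (hκ : ∀ s ≤ s₁, HasDerivAt κ (κ' s) s)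
    (h : ∀ s ≤ s₁, κ' s * a s ≤ a' s) :
    ∀ s ≤ s₁, a s ≤ a s₁ * Real.exp (κ s - κ s₁) := by
  have hder : ∀ s ≤ s₁, HasDerivAt (fun s => a s * Real.exp (-κ s))
      ((a' s - κ' s * a s) * Real.exp (-κ s)) s := by
    intro s hs
    convert! (ha s hs).mul (hκ s hs).neg.exp using 1
    simp only [Pi.neg_apply]
    ring
  have hmono : MonotoneOn (fun s => a s * Real.exp (-κ s)) (Iic s₁) := by
    refine monotoneOn_of_deriv_nonneg (convex_Iic _)
      (fun s hs => (hder s hs).continuousAt.continuousWithinAt)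
      (fun s hs => ?_) (fun s hs => ?_)
    all_goals rw [interior_Iic] at hs
    · exact (hder s hs.le).differentiableAt.differentiableWithinAt
    · rw [(hder s hs.le).deriv]
      exact mul_nonneg (sub_nonneg.2 (h s hs.le)) (Real.exp_pos _).le
  intro s hs
  have h1 := hmono hs (mem_Iic.2 le_rfl) hs
  simp only at h1
  calc a s = a s * Real.exp (-κ s) * Real.exp (κ s) := by
        rw [mul_assoc, ← Real.exp_add]; simp
    _ ≤ a s₁ * Real.exp (-κ s₁) * Real.exp (κ s) := by gcongr
    _ = _ := by rw [mul_assoc, ← Real.exp_add]; ring_nf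

theorem trace_rotate (B : ℂ →L[ℝ] ℂ →L[ℝ] ℝ) (e : ℂ) :
    B e e + B (e * I) (e * I) = ‖e‖ ^ 2 * (B 1 1 + B I I) := by
  have h1 : e = e.re • (1 : ℂ) + e.im • I := by simp
  have h2 : e * I = (-e.im) • (1 : ℂ) + e.re • I := by
    apply Complex.ext <;> simp
  have h3 : ‖e‖ ^ 2 = e.re ^ 2 + e.im ^ 2 := by
    rw [← Complex.normSq_eq_norm_sq, Complex.normSq_apply]; ring
  rw [h2, h3]
  nth_rw 1 2 [h1]
  simp only [map_add, map_smul, add_apply, smul_apply, smul_eq_mul]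
  ring

theorem hasDerivAt_exp_mul_I (t : ℝ) :
    HasDerivAt (fun t : ℝ => Complex.exp (t * I)) (Complex.exp (t * I) * I) t := by
  have h := ((Complex.hasDerivAt_exp (t * I)).comp (t : ℂ)
    ((hasDerivAt_id (t : ℂ)).mul_const I)).comp_ofReal
  simpa [Function.comp_def] using h

set_option maxHeartbeats 1600000 in
/-- Circle averages of a function with Laplacian bounded below. -/
theorem circle_mean_ge {f : ℂ → ℝ} {z₀ : ℂ} {R b : ℝ}
    (hf : ContDiffOn ℝ 2 f (ball z₀ R))
    (hL : ∀ z ∈ ball z₀ R, -b ≤ fderiv ℝ (fderiv ℝ f) z 1 1 + fderiv ℝ (fderiv ℝ f) z I I)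
    {r : ℝ} (hr₀ : 0 ≤ r) (hrR : r < R) :
    2 * π * f z₀ - π * b * r ^ 2 / 2 ≤ ∫ t in (-π)..π, f (z₀ + r * Complex.exp (t * I)) := by
  have hR : 0 < R := hr₀.trans_lt hrR
  set c : ℝ → ℂ := fun t => Complex.exp (t * I) with hc
  have hcc : Continuous c := by fun_prop
  have hcn : ∀ t, ‖c t‖ = 1 := fun t => Complex.norm_exp_ofReal_mul_I t
  have hcd : ∀ t, HasDerivAt c (c t * I) t := hasDerivAt_exp_mul_I
  set U : Set ℝ := Ioo (-R) R
  have hU : IsOpen U := isOpen_Ioo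
  have hmem : ∀ s ∈ U, ∀ t, z₀ + s * c t ∈ ball z₀ R := by
    intro s hs t
    simp only [mem_ball, dist_self_add_left, norm_mul, hcn, Complex.norm_real, mul_one]
    exact abs_lt.2 hs
  have hcirc : ContinuousOn (fun p : ℝ × ℝ => z₀ + p.1 * c p.2) (U ×ˢ univ) := by fun_prop
  have hmaps : MapsTo (fun p : ℝ × ℝ => z₀ + p.1 * c p.2) (U ×ˢ univ) (ball z₀ R) :=
    fun p hp => hmem p.1 hp.1 p.2
  have hF : ContDiffOn ℝ 1 (fderiv ℝ f) (ball z₀ R) :=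
    hf.fderiv_of_isOpen isOpen_ball (by norm_num)
  have hF' : ContinuousOn (fderiv ℝ (fderiv ℝ f)) (ball z₀ R) :=
    (hF.fderiv_of_isOpen (m := 0) isOpen_ball (by norm_num)).continuousOn
  have hfd : ∀ z ∈ ball z₀ R, HasFDerivAt f (fderiv ℝ f z) z := fun z hz =>
    ((hf.differentiableOn (by norm_num)).differentiableAt (isOpen_ball.mem_nhds hz)).hasFDerivAt
  have hFd : ∀ z ∈ ball z₀ R, HasFDerivAt (fderiv ℝ f) (fderiv ℝ (fderiv ℝ f) z) z := fun z hz =>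
    ((hF.differentiableOn (by norm_num)).differentiableAt (isOpen_ball.mem_nhds hz)).hasFDerivAt
  have hrad : ∀ s t, HasDerivAt (fun s : ℝ => z₀ + s * c t) (c t) s := by
    intro s t
    simpa using ((Complex.ofRealCLM.hasDerivAt (x := s)).mul_const (c t)).const_add z₀
  have hang : ∀ s t, HasDerivAt (fun t : ℝ => z₀ + s * c t) (s * (c t * I)) t := by
    intro s t
    exact ((hcd t).const_mul (s : ℂ)).const_add z₀
  have hcont : ∀ {E : Type} [TopologicalSpace E] {g : ℂ → E}, ContinuousOn g (ball z₀ R) →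
      ∀ s ∈ U, Continuous fun t => g (z₀ + s * c t) := fun hg s hs =>
    hg.comp_continuous (by fun_prop) (hmem s hs)
  -- the first radial derivative
  have h1 : ∀ s ∈ U, HasDerivAt (fun s : ℝ => ∫ t in (-π)..π, f (z₀ + s * c t))
      (∫ t in (-π)..π, fderiv ℝ f (z₀ + s * c t) (c t)) s := by
    intro s hs
    refine hasDerivAt_intervalIntegral hU (g := fun s t => f (z₀ + s * c t))
      (g' := fun s t => fderiv ℝ f (z₀ + s * c t) (c t))
      (fun s hs t => (hfd _ (hmem s hs t)).comp_hasDerivAt s (hrad s t))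
      (hcont hf.continuousOn) ?_ hs _ _
    exact (hF.continuousOn.comp hcirc hmaps).clm_apply (by fun_prop)
  -- the radial derivative of `r dφ/dr`
  have h2 : ∀ s ∈ U, HasDerivAt (fun s : ℝ => ∫ t in (-π)..π, fderiv ℝ f (z₀ + s * c t) (s * c t))
      (∫ t in (-π)..π, (fderiv ℝ (fderiv ℝ f) (z₀ + s * c t) (c t) (s * c t)
        + fderiv ℝ f (z₀ + s * c t) (c t))) s := by
    intro s hs
    refine hasDerivAt_intervalIntegral hU (g := fun s t => fderiv ℝ f (z₀ + s * c t) (s * c t))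
      (g' := fun s t => fderiv ℝ (fderiv ℝ f) (z₀ + s * c t) (c t) (s * c t)
        + fderiv ℝ f (z₀ + s * c t) (c t)) (fun s hs t => ?_) (fun s hs => ?_) ?_ hs _ _
    · refine HasDerivAt.clm_apply ((hFd _ (hmem s hs t)).comp_hasDerivAt s (hrad s t)) ?_
      simpa using ((Complex.ofRealCLM.hasDerivAt (x := s)).mul_const (c t))
    · exact (hcont hF.continuousOn s hs).clm_apply (by fun_prop)
    · refine ContinuousOn.add ?_ ?_
      · exact ((hF'.comp hcirc hmaps).clm_apply (by fun_prop)).clm_apply (by fun_prop)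
      · exact (hF.continuousOn.comp hcirc hmaps).clm_apply (by fun_prop)
  -- the angular derivative integrates to zero
  have h3 : ∀ s ∈ U, ∫ t in (-π)..π, (fderiv ℝ (fderiv ℝ f) (z₀ + s * c t) (s * (c t * I)) (c t * I)
        + fderiv ℝ f (z₀ + s * c t) (c t * I * I)) = 0 := by
    intro s hs
    have hd : ∀ t, HasDerivAt (fun t => fderiv ℝ f (z₀ + s * c t) (c t * I))
        (fderiv ℝ (fderiv ℝ f) (z₀ + s * c t) (s * (c t * I)) (c t * I)
        + fderiv ℝ f (z₀ + s * c t) (c t * I * I)) t := fun t =>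
      ((hFd _ (hmem s hs t)).comp_hasDerivAt t (hang s t)).clm_apply ((hcd t).mul_const I)
    rw [intervalIntegral.integral_eq_sub_of_hasDerivAt (fun t _ => hd t)]
    · have : c π = c (-π) := by simp [hc, Complex.exp_neg]
      rw [this, sub_self]
    · refine Continuous.intervalIntegrable (Continuous.add ?_ ?_) _ _
      · exact ((hcont hF' s hs).clm_apply (by fun_prop)).clm_apply (by fun_prop)
      · exact (hcont hF.continuousOn s hs).clm_apply (by fun_prop)
  have h4 : ∀ s ∈ U, 0 ≤ s → -(2 * π * b * s) ≤
      ∫ t in (-π)..π, (fderiv ℝ (fderiv ℝ f) (z₀ + s * c t) (c t) (s * c t)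
        + fderiv ℝ f (z₀ + s * c t) (c t)) := by
    intro s hs hs0
    rw [← add_zero (∫ t in (-π)..π, _), ← h3 s hs, ← intervalIntegral.integral_add]
    · have : -(2 * π * b * s) = ∫ t in (-π)..π, s * (-b) := by
        rw [intervalIntegral.integral_const]; simp; ring
      rw [this]
      refine intervalIntegral.integral_mono_on (by linarith [Real.pi_pos])
        intervalIntegrable_const ?_ fun t _ => ?_
      · refine Continuous.intervalIntegrable (Continuous.add (Continuous.add ?_ ?_)
          (Continuous.add ?_ ?_)) _ _
        · exact ((hcont hF' s hs).clm_apply (by fun_prop)).clm_apply (by fun_prop)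
        · exact (hcont hF.continuousOn s hs).clm_apply (by fun_prop)
        · exact ((hcont hF' s hs).clm_apply (by fun_prop)).clm_apply (by fun_prop)
        · exact (hcont hF.continuousOn s hs).clm_apply (by fun_prop)
      · have e1 := trace_rotate (fderiv ℝ (fderiv ℝ f) (z₀ + s * c t)) (c t)
        rw [hcn, one_pow, one_mul] at e1
        have e2 : c t * I * I = -c t := by rw [mul_assoc, I_mul_I]; ring
        have e3 : ∀ w : ℂ, (s : ℂ) * w = s • w := fun w => (Complex.real_smul).symm
        have := mul_le_mul_of_nonneg_left (hL _ (hmem s hs t)) hs0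
        rw [e2, e3 (c t * I), map_neg, map_smul, smul_apply, e3 (c t), map_smul, smul_eq_mul,
          smul_eq_mul]
        rw [e3] at this e1
        rw [← e1] at this
        linarith
    · refine Continuous.intervalIntegrable (Continuous.add ?_ ?_) _ _
      · exact ((hcont hF' s hs).clm_apply (by fun_prop)).clm_apply (by fun_prop)
      · exact (hcont hF.continuousOn s hs).clm_apply (by fun_prop)
    · refine Continuous.intervalIntegrable (Continuous.add ?_ ?_) _ _
      · exact ((hcont hF' s hs).clm_apply (by fun_prop)).clm_apply (by fun_prop)
      · exact (hcont hF.continuousOn s hs).clm_apply (by fun_prop)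
  have hsub : Ico 0 R ⊆ U := fun s hs => ⟨by linarith [hs.1], hs.2⟩
  have h5 : MonotoneOn (fun s : ℝ => (∫ t in (-π)..π, fderiv ℝ f (z₀ + s * c t) (s * c t))
      + π * b * s ^ 2) (Ico 0 R) := by
    have hd : ∀ s ∈ U, HasDerivAt (fun s : ℝ =>
        (∫ t in (-π)..π, fderiv ℝ f (z₀ + s * c t) (s * c t)) + π * b * s ^ 2) _ s := fun s hs =>
      (h2 s hs).add (((hasDerivAt_id s).pow 2).const_mul (π * b))
    refine monotoneOn_of_deriv_nonneg (convex_Ico _ _)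
      (fun s hs => (hd s (hsub hs)).continuousAt.continuousWithinAt)
      (fun s hs => (hd s (hsub (interior_subset hs))).differentiableAt.differentiableWithinAt)
      (fun s hs => ?_)
    have hs' := interior_subset hs
    rw [(hd s (hsub hs')).deriv]
    have := h4 s (hsub hs') hs'.1
    simp only [id, Nat.cast_ofNat, mul_one]
    norm_num
    linarith
  have h6 : ∀ s ∈ Ico 0 R, 0 < s → -(π * b * s) ≤
      ∫ t in (-π)..π, fderiv ℝ f (z₀ + s * c t) (c t) := by
    intro s hs hs0
    have := h5 (left_mem_Ico.2 hR) hs hs.1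
    simp only [ofReal_zero, zero_mul, map_zero, intervalIntegral.integral_zero] at this
    have e3 : ∀ w : ℂ, (s : ℂ) * w = s • w := fun w => (Complex.real_smul).symm
    have e4 : ∫ t in (-π)..π, fderiv ℝ f (z₀ + s * c t) (s * c t) =
        s * ∫ t in (-π)..π, fderiv ℝ f (z₀ + s * c t) (c t) := by
      rw [← intervalIntegral.integral_const_mul]
      congr 1; ext t; rw [e3, map_smul, smul_eq_mul]
    rw [e4] at this
    refine le_of_mul_le_mul_left ?_ hs0
    nlinarith
  have h7 : MonotoneOn (fun s : ℝ => (∫ t in (-π)..π, f (z₀ + s * c t))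
      + π * b * s ^ 2 / 2) (Ico 0 R) := by
    have hd : ∀ s ∈ U, HasDerivAt (fun s : ℝ =>
        (∫ t in (-π)..π, f (z₀ + s * c t)) + π * b * s ^ 2 / 2) _ s := fun s hs =>
      (h1 s hs).add ((((hasDerivAt_id s).pow 2).const_mul (π * b)).div_const 2)
    refine monotoneOn_of_deriv_nonneg (convex_Ico _ _)
      (fun s hs => (hd s (hsub hs)).continuousAt.continuousWithinAt)
      (fun s hs => (hd s (hsub (interior_subset hs))).differentiableAt.differentiableWithinAt)
      (fun s hs => ?_)
    have hs' := interior_subset hs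
    rw [interior_Ico] at hs
    rw [(hd s (hsub hs')).deriv]
    have := h6 s hs' hs.1
    simp only [id, Nat.cast_ofNat, mul_one]
    norm_num
    linarith
  have h8 := h7 (left_mem_Ico.2 hR) ⟨hr₀, hrR⟩ hr₀
  simp only [ofReal_zero, zero_mul, add_zero, intervalIntegral.integral_const, smul_eq_mul] at h8
  nlinarith

/-- Area form of the mean value inequality. -/
theorem area_mean_ge {f : ℂ → ℝ} {z₀ : ℂ} {R b δ : ℝ}
    (hf : ContDiffOn ℝ 2 f (ball z₀ R))
    (hL : ∀ z ∈ ball z₀ R, -b ≤ fderiv ℝ (fderiv ℝ f) z 1 1 + fderiv ℝ (fderiv ℝ f) z I I)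
    (hδ : 0 < δ) (hδR : δ < R) :
    π * δ ^ 2 * f z₀ ≤ (∫ z in ball z₀ δ, f z) + π * b * δ ^ 4 / 8 := by
  have hfc : ContinuousOn f (ball z₀ R) := hf.continuousOn
  have hmaps : MapsTo (fun p : ℝ × ℝ => z₀ + p.1 * Complex.exp (p.2 * I))
      (Icc 0 δ ×ˢ Icc (-π) π) (ball z₀ R) := by
    intro p hp
    simp only [mem_ball, dist_self_add_left, norm_mul, Complex.norm_exp_ofReal_mul_I,
      Complex.norm_real, mul_one, Real.norm_eq_abs, abs_of_nonneg hp.1.1]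
    exact hp.1.2.trans_lt hδR
  have hgc : ContinuousOn (fun p : ℝ × ℝ => p.1 * f (z₀ + p.1 * Complex.exp (p.2 * I)))
      (Icc 0 δ ×ˢ Icc (-π) π) :=
    continuousOn_fst.mul (hfc.comp (by fun_prop) hmaps)
  have hgi : IntegrableOn (fun p : ℝ × ℝ => p.1 * f (z₀ + p.1 * Complex.exp (p.2 * I)))
      (Icc 0 δ ×ˢ Icc (-π) π) (volume.prod volume) := by
    exact hgc.integrableOn_compact (isCompact_Icc.prod isCompact_Icc)
  have hsub : Ioo 0 δ ×ˢ Ioo (-π) π ⊆ Icc 0 δ ×ˢ Icc (-π) π :=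
    prod_mono Ioo_subset_Icc_self Ioo_subset_Icc_self
  have e1 : ∫ z in ball z₀ δ, f z = ∫ p in Ioo 0 δ ×ˢ Ioo (-π) π,
      p.1 * f (z₀ + p.1 * Complex.exp (p.2 * I)) := by
    rw [← integral_indicator measurableSet_ball,
      ← integral_add_left_eq_self _ z₀, ← Complex.integral_comp_polarCoord_symm,
      ← integral_indicator polarCoord.open_target.measurableSet,
      ← integral_indicator (measurableSet_Ioo.prod measurableSet_Ioo)]
    congr 1
    ext p
    have ep : Complex.polarCoord.symm p = p.1 * Complex.exp (p.2 * I) := by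
      rw [Complex.polarCoord_symm_apply, Complex.exp_mul_I, ofReal_cos, ofReal_sin]
    by_cases hp : p ∈ polarCoord.target
    · have hp' := hp
      rw [polarCoord_target] at hp'
      rw [indicator_of_mem hp, ep]
      by_cases hp1 : p.1 < δ
      · rw [indicator_of_mem, indicator_of_mem, smul_eq_mul]
        · exact ⟨⟨hp'.1, hp1⟩, hp'.2⟩
        · simpa [mem_ball, abs_of_pos (show 0 < p.1 from hp'.1)] using hp1
      · rw [indicator_of_notMem, indicator_of_notMem, smul_zero]
        · exact fun h => hp1 h.1.2
        · simpa [mem_ball, abs_of_pos (show 0 < p.1 from hp'.1)] using hp1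
    · rw [indicator_of_notMem hp, indicator_of_notMem]
      rw [polarCoord_target] at hp
      exact fun h => hp ⟨h.1.1, h.2⟩
  rw [e1, Measure.volume_eq_prod, setIntegral_prod _ (hgi.mono_set hsub)]
  have e2 : ∀ r : ℝ, ∫ t in Ioo (-π) π, r * f (z₀ + r * Complex.exp (t * I)) =
      r * ∫ t in (-π)..π, f (z₀ + r * Complex.exp (t * I)) := by
    intro r
    rw [intervalIntegral.integral_of_le (by linarith [Real.pi_pos]), integral_Ioc_eq_integral_Ioo,
      integral_const_mul]
  simp only [e2]
  have hint := hgi.mono_set hsub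
  rw [IntegrableOn, ← Measure.prod_restrict] at hint
  have hint2 : IntegrableOn (fun r : ℝ => r * ∫ t in (-π)..π, f (z₀ + r * Complex.exp (t * I)))
      (Ioo 0 δ) := by
    have := hint.integral_prod_left
    simpa only [e2, IntegrableOn] using this
  have hlow : ∫ r in Ioo 0 δ, (2 * π * f z₀ * r - π * b / 2 * r ^ 3) ≤
      ∫ r in Ioo 0 δ, r * ∫ t in (-π)..π, f (z₀ + r * Complex.exp (t * I)) := by
    refine setIntegral_mono_on ?_ hint2 measurableSet_Ioo fun r hr => ?_
    · exact (Continuous.integrableOn_Icc (by fun_prop)).mono_set Ioo_subset_Icc_self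
    · have := mul_le_mul_of_nonneg_left (circle_mean_ge hf hL hr.1.le (hr.2.trans hδR)) hr.1.le
      linarith
  have e3 : ∫ r in Ioo 0 δ, (2 * π * f z₀ * r - π * b / 2 * r ^ 3) =
      π * δ ^ 2 * f z₀ - π * b * δ ^ 4 / 8 := by
    rw [← integral_Ioc_eq_integral_Ioo, ← intervalIntegral.integral_of_le hδ.le,
      intervalIntegral.integral_sub (Continuous.intervalIntegrable (by fun_prop) _ _)
        (Continuous.intervalIntegrable (by fun_prop) _ _),
      intervalIntegral.integral_const_mul, intervalIntegral.integral_const_mul, integral_id,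
      integral_pow]
    norm_num
    ring
  linarith

/-- Heinz's trick: small energy gives a pointwise bound for nonnegative functions satisfying
`Δf ≥ -A f²`. -/
theorem heinz {f : ℂ → ℝ} {z₀ : ℂ} {R r A E : ℝ} (hA : 0 < A)
    (hf : ContDiffOn ℝ 2 f (ball z₀ R)) (hf0 : ∀ z ∈ ball z₀ R, 0 ≤ f z)
    (hL : ∀ z ∈ ball z₀ R,
      -(A * f z ^ 2) ≤ fderiv ℝ (fderiv ℝ f) z 1 1 + fderiv ℝ (fderiv ℝ f) z I I)
    (hr : 0 < r) (hrR : r < R) (hE : ∫ z in ball z₀ r, f z ≤ E) (hsmall : A * E < 1 / 4) :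
    r ^ 2 * f z₀ ≤ 8 * E := by
  have hsubR : closedBall z₀ r ⊆ ball z₀ R := closedBall_subset_ball hrR
  have hint : IntegrableOn f (ball z₀ r) :=
    ((hf.continuousOn.mono hsubR).integrableOn_compact (isCompact_closedBall _ _)).mono_set
      ball_subset_closedBall
  obtain ⟨z₁, hz₁, hmax⟩ := (isCompact_closedBall z₀ r).exists_isMaxOn
    (f := fun z => (r - dist z z₀) ^ 2 * f z) ⟨z₀, mem_closedBall_self hr.le⟩
    (ContinuousOn.mul (by fun_prop) (hf.continuousOn.mono hsubR))
  set ρ := r - dist z₁ z₀ with hρ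
  set m := f z₁ with hm
  have hm0 : 0 ≤ m := hf0 _ (hsubR hz₁)
  have hmax' : ∀ z ∈ closedBall z₀ r, (r - dist z z₀) ^ 2 * f z ≤ ρ ^ 2 * m := fun z hz => hmax hz
  have h0 : r ^ 2 * f z₀ ≤ ρ ^ 2 * m := by
    have := hmax' z₀ (mem_closedBall_self hr.le)
    simpa using this
  have hρ0 : 0 ≤ ρ := sub_nonneg.2 (mem_closedBall.1 hz₁)
  have hE0 : 0 ≤ E := (setIntegral_nonneg measurableSet_ball
    fun z hz => hf0 z (hsubR (ball_subset_closedBall hz))).trans hE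
  refine h0.trans ?_
  rcases hρ0.eq_or_lt with h | hρpos
  · rw [← h]; simpa using hE0
  rcases hm0.eq_or_lt with h | hmpos
  · rw [← h]; simpa using hE0
  have hball : ∀ z ∈ ball z₁ (ρ / 2), z ∈ ball z₀ r ∧ f z ≤ 4 * m := by
    intro z hz
    rw [mem_ball] at hz
    have hd : dist z z₀ ≤ dist z z₁ + dist z₁ z₀ := dist_triangle _ _ _
    have hzr : z ∈ ball z₀ r := by rw [mem_ball]; linarith
    refine ⟨hzr, ?_⟩
    have h1 := hmax' z (ball_subset_closedBall hzr)
    have h2 : ρ / 2 ≤ r - dist z z₀ := by linarith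
    have h3 : (ρ / 2) ^ 2 * f z ≤ ρ ^ 2 * m :=
      (mul_le_mul_of_nonneg_right (pow_le_pow_left₀ (by positivity) h2 2)
        (hf0 _ (hsubR (ball_subset_closedBall hzr)))).trans h1
    refine le_of_mul_le_mul_left ?_ (pow_pos hρpos 2)
    linarith
  have hMV : ∀ δ, 0 < δ → δ < ρ / 2 → π * δ ^ 2 * m ≤ E + 2 * π * A * m ^ 2 * δ ^ 4 := by
    intro δ hδ hδρ
    have hsub : ball z₁ (ρ / 2) ⊆ ball z₀ R := fun z hz =>
      hsubR (ball_subset_closedBall (hball z hz).1)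
    have := area_mean_ge (b := 16 * A * m ^ 2) (hf.mono hsub) (fun z hz => ?_) hδ hδρ
    · have h1 : ∫ z in ball z₁ δ, f z ≤ ∫ z in ball z₀ r, f z := by
        refine setIntegral_mono_set hint ?_ (LE.le.eventuallyLE ?_)
        · exact (ae_restrict_iff' measurableSet_ball).2
            (.of_forall fun z hz => hf0 z (hsubR (ball_subset_closedBall hz)))
        · exact fun z hz => (hball z (ball_subset_ball hδρ.le hz)).1
      linarith
    · refine le_trans ?_ (hL z (hsub hz))
      have h1 : f z ^ 2 ≤ (4 * m) ^ 2 :=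
        pow_le_pow_left₀ (hf0 z (hsub hz)) (hball z hz).2 2
      have := mul_le_mul_of_nonneg_left h1 hA.le
      linarith
  -- the inequality extends to `δ = ρ / 2` by continuity
  have hMV' : ∀ δ, 0 < δ → δ ≤ ρ / 2 → π * δ ^ 2 * m ≤ E + 2 * π * A * m ^ 2 * δ ^ 4 := by
    intro δ hδ hδρ
    have hcl : δ ∈ closure (Ioo 0 (ρ / 2)) := by
      rw [closure_Ioo (by positivity)]; exact ⟨hδ.le, hδρ⟩
    exact le_on_closure (f := fun δ => π * δ ^ 2 * m)
      (g := fun δ => E + 2 * π * A * m ^ 2 * δ ^ 4) (fun x hx => hMV x hx.1 hx.2)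
      (by fun_prop) (by fun_prop) hcl
  have hpi := Real.pi_gt_three
  by_cases hcase : 1 / (4 * A * m) ≤ (ρ / 2) ^ 2
  · exfalso
    have hpos : 0 < 1 / (4 * A * m) := by positivity
    have h := hMV' (Real.sqrt (1 / (4 * A * m))) (Real.sqrt_pos.2 hpos)
      (Real.sqrt_le_iff.2 ⟨by positivity, hcase⟩)
    have h4 : Real.sqrt (1 / (4 * A * m)) ^ 4 = (1 / (4 * A * m)) ^ 2 := by
      rw [show 4 = 2 * 2 from rfl, pow_mul, Real.sq_sqrt hpos.le]
    rw [h4, Real.sq_sqrt hpos.le] at h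
    have e1 : π * (1 / (4 * A * m)) * m = π / (4 * A) := by field_simp
    have e2 : 2 * π * A * m ^ 2 * (1 / (4 * A * m)) ^ 2 = π / (8 * A) := by field_simp; norm_num
    rw [e1, e2] at h
    have e3 : π / (4 * A) = 2 * (π / (8 * A)) := by field_simp; norm_num
    have h5 : π / (8 * A) ≤ E := by linarith
    rw [div_le_iff₀ (by positivity)] at h5
    linarith
  · push Not at hcase
    rw [lt_div_iff₀ (by positivity)] at hcase
    have h := hMV' (ρ / 2) (by positivity) le_rfl
    have h6 : π * m * ρ ^ 2 * (A * m * ρ ^ 2) ≤ π * m * ρ ^ 2 * 1 := by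
      gcongr; linarith
    have h7 : π * (ρ ^ 2 * m) ≤ 8 * E := by nlinarith
    nlinarith [show 0 ≤ ρ ^ 2 * m by positivity]

section Curves

variable {V : Type*} [NormedAddCommGroup V] [NormedSpace ℝ V]

/-- `u` is a smooth `J`-holomorphic curve on `Ω`. -/
structure IsHolOn (J : V → V →L[ℝ] V) (u : ℂ → V) (Ω : Set ℂ) : Prop where
  contDiffOn : ContDiffOn ℝ (⊤ : ℕ∞) u Ω
  cauchyRiemann : ∀ z ∈ Ω, fderiv ℝ u z 1 + J (u z) (fderiv ℝ u z I) = 0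

theorem contDiffOn_fderiv_apply {u : ℂ → V} {Ω : Set ℂ} (hΩ : IsOpen Ω)
    (hu : ContDiffOn ℝ (⊤ : ℕ∞) u Ω) (h : ℂ) :
    ContDiffOn ℝ (⊤ : ℕ∞) (fun z => fderiv ℝ u z h) Ω :=
  (hu.fderiv_of_isOpen hΩ (by simp)).clm_apply contDiffOn_const

theorem hasFDerivAt_of_smooth {u : ℂ → V} {Ω : Set ℂ} (hΩ : IsOpen Ω)
    (hu : ContDiffOn ℝ (⊤ : ℕ∞) u Ω) {z : ℂ} (hz : z ∈ Ω) : HasFDerivAt u (fderiv ℝ u z) z :=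
  ((hu.differentiableOn (by simp)).differentiableAt (hΩ.mem_nhds hz)).hasFDerivAt

theorem fderiv_fderiv_apply {u : ℂ → V} {Ω : Set ℂ} (hΩ : IsOpen Ω)
    (hu : ContDiffOn ℝ (⊤ : ℕ∞) u Ω) {z : ℂ} (hz : z ∈ Ω) (h k : ℂ) :
    fderiv ℝ (fun z => fderiv ℝ u z h) z k = fderiv ℝ (fderiv ℝ u) z k h := by
  have h1 := hasFDerivAt_of_smooth hΩ (hu.fderiv_of_isOpen hΩ (by simp)) hz
  simpa using congrArg (· k) (h1.clm_apply (hasFDerivAt_const h z)).fderiv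

theorem fderiv_comm {u : ℂ → V} {Ω : Set ℂ} (hΩ : IsOpen Ω)
    (hu : ContDiffOn ℝ (⊤ : ℕ∞) u Ω) {z : ℂ} (hz : z ∈ Ω) (h k : ℂ) :
    fderiv ℝ (fun z => fderiv ℝ u z h) z k = fderiv ℝ (fun z => fderiv ℝ u z k) z h := by
  rw [fderiv_fderiv_apply hΩ hu hz, fderiv_fderiv_apply hΩ hu hz]
  exact second_derivative_symmetric_of_eventually (f := u) (f' := fderiv ℝ u)
    (by filter_upwards [hΩ.mem_nhds hz] with w hw using hasFDerivAt_of_smooth hΩ hu hw)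
    (hasFDerivAt_of_smooth hΩ (hu.fderiv_of_isOpen hΩ (by simp)) hz) _ _

variable {J : V → V →L[ℝ] V} {u : ℂ → V} {Ω : Set ℂ}

theorem IsHolOn.fderiv_one (hu : IsHolOn J u Ω) {z : ℂ} (hz : z ∈ Ω) :
    fderiv ℝ u z 1 = -J (u z) (fderiv ℝ u z I) :=
  eq_neg_of_add_eq_zero_left (hu.cauchyRiemann z hz)

/-- The equation satisfied by the derivative of a `J`-holomorphic curve. -/
theorem IsHolOn.linearized (hΩ : IsOpen Ω) (hJ : ContDiff ℝ (⊤ : ℕ∞) J) (hu : IsHolOn J u Ω)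
    {z : ℂ} (hz : z ∈ Ω) :
    fderiv ℝ (fun z => fderiv ℝ u z I) z 1 =
      -(J (u z) (fderiv ℝ (fun z => fderiv ℝ u z I) z I)
        + fderiv ℝ J (u z) (fderiv ℝ u z I) (fderiv ℝ u z I)) := by
  rw [fderiv_comm hΩ hu.contDiffOn hz]
  have heq : (fun z => fderiv ℝ u z 1) =ᶠ[𝓝 z] fun z => -J (u z) (fderiv ℝ u z I) := by
    filter_upwards [hΩ.mem_nhds hz] with w hw using hu.fderiv_one hw
  rw [heq.fderiv_eq]
  have hJd : HasFDerivAt J (fderiv ℝ J (u z)) (u z) :=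
    (hJ.differentiable (by simp) _).hasFDerivAt
  have h1 := ((hJd.comp z (hasFDerivAt_of_smooth hΩ hu.contDiffOn hz)).clm_apply
    (hasFDerivAt_of_smooth hΩ (contDiffOn_fderiv_apply hΩ hu.contDiffOn I) hz)).fun_neg
  have h2 := congrArg (· I) h1.fderiv
  simpa [Function.comp_def] using h2

/-- The complete lift of an almost complex structure to the tangent bundle. -/
noncomputable def lift (J : V → V →L[ℝ] V) (y : V × V) : V × V →L[ℝ] V × V :=
  ((J y.1).comp (ContinuousLinearMap.fst ℝ V V)).prod
    ((J y.1).comp (ContinuousLinearMap.snd ℝ V V)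
      + (fderiv ℝ J y.1 y.2).comp (ContinuousLinearMap.fst ℝ V V))

@[simp]
theorem lift_apply (y v : V × V) :
    lift J y v = (J y.1 v.1, J y.1 v.2 + fderiv ℝ J y.1 y.2 v.1) := rfl

theorem contDiff_lift (hJ : ContDiff ℝ (⊤ : ℕ∞) J) : ContDiff ℝ (⊤ : ℕ∞) (lift J) := by
  have h1 : ContDiff ℝ (⊤ : ℕ∞) fun y : V × V => J y.1 := hJ.comp contDiff_fst
  have h2 : ContDiff ℝ (⊤ : ℕ∞) fun y : V × V => fderiv ℝ J y.1 y.2 :=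
    ((hJ.fderiv_right (by simp)).comp contDiff_fst).clm_apply contDiff_snd
  have e : lift J = fun y => (ContinuousLinearMap.inl ℝ V V).comp
        ((J y.1).comp (ContinuousLinearMap.fst ℝ V V))
      + (ContinuousLinearMap.inr ℝ V V).comp ((J y.1).comp (ContinuousLinearMap.snd ℝ V V)
      + (fderiv ℝ J y.1 y.2).comp (ContinuousLinearMap.fst ℝ V V)) := by
    ext y v <;> simp [lift]
  rw [e]
  exact (contDiff_const.clm_comp (h1.clm_comp contDiff_const)).add
    (contDiff_const.clm_comp ((h1.clm_comp contDiff_const).add (h2.clm_comp contDiff_const)))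

/-- Differentiating `J² = -1`. -/
theorem fderiv_sq (hJ : ContDiff ℝ (⊤ : ℕ∞) J) (hJ2 : ∀ x v, J x (J x v) = -v) (x w v : V) :
    fderiv ℝ J x w (J x v) + J x (fderiv ℝ J x w v) = 0 := by
  have hJd : HasFDerivAt J (fderiv ℝ J x) x := (hJ.differentiable (by simp) _).hasFDerivAt
  have h1 := hJd.clm_apply (hJd.clm_apply (hasFDerivAt_const v x))
  have h2 : (fun x => J x (J x v)) = fun _ => -v := funext fun x => hJ2 x v
  rw [h2] at h1
  have := congrArg (· w) (h1.unique (hasFDerivAt_const (-v) x))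
  simp at this
  rw [add_comm]; exact this

theorem lift_sq (hJ : ContDiff ℝ (⊤ : ℕ∞) J) (hJ2 : ∀ x v, J x (J x v) = -v) (y v : V × V) :
    lift J y (lift J y v) = -v := by
  ext
  · simp [hJ2]
  · have := fderiv_sq hJ hJ2 y.1 y.2 v.1
    simp only [lift_apply, map_add, hJ2, Prod.snd_neg]
    rw [add_assoc, add_comm (J y.1 _), this, add_zero]

/-- A `J`-holomorphic curve together with its derivative is holomorphic for the complete lift. -/
theorem IsHolOn.lift (hΩ : IsOpen Ω) (hJ : ContDiff ℝ (⊤ : ℕ∞) J) (hu : IsHolOn J u Ω) :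
    IsHolOn (lift J) (fun z => (u z, fderiv ℝ u z I)) Ω := by
  refine ⟨hu.contDiffOn.prodMk (contDiffOn_fderiv_apply hΩ hu.contDiffOn I), fun z hz => ?_⟩
  have h1 := (hasFDerivAt_of_smooth hΩ hu.contDiffOn hz).prodMk
    (hasFDerivAt_of_smooth hΩ (contDiffOn_fderiv_apply hΩ hu.contDiffOn I) hz)
  rw [h1.fderiv]
  ext
  · simp [hu.fderiv_one hz]
  · simp [hu.linearized hΩ hJ hz]

end Curves

section Laplace

variable {V : Type*} [NormedAddCommGroup V] [InnerProductSpace ℝ V]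

theorem hessian_norm_sq {W : ℂ → V} {Ω : Set ℂ} (hΩ : IsOpen Ω)
    (hW : ContDiffOn ℝ (⊤ : ℕ∞) W Ω) {z : ℂ} (hz : z ∈ Ω) (h : ℂ) :
    fderiv ℝ (fderiv ℝ (fun z => ‖W z‖ ^ 2)) z h h =
      2 * (‖fderiv ℝ W z h‖ ^ 2 + inner ℝ (W z) (fderiv ℝ (fun z => fderiv ℝ W z h) z h)) := by
  have hf : ContDiffOn ℝ (⊤ : ℕ∞) (fun z => ‖W z‖ ^ 2) Ω := hW.norm_sq ℝ
  rw [← fderiv_fderiv_apply hΩ hf hz]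
  have heq : (fun z => fderiv ℝ (fun z => ‖W z‖ ^ 2) z h) =ᶠ[𝓝 z]
      fun z => 2 * inner ℝ (W z) (fderiv ℝ W z h) := by
    filter_upwards [hΩ.mem_nhds hz] with w hw
    rw [(hasFDerivAt_of_smooth hΩ hW hw).norm_sq.fderiv]
    simp
  rw [heq.fderiv_eq]
  have h1 := ((hasFDerivAt_of_smooth hΩ hW hz).inner ℝ
    (hasFDerivAt_of_smooth hΩ (contDiffOn_fderiv_apply hΩ hW h) hz)).const_mul 2
  rw [h1.fderiv]
  simp [fderivInnerCLM_apply]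
  ring

set_option maxSynthPendingDepth 6 in
set_option synthInstance.maxHeartbeats 400000 in
set_option maxHeartbeats 1600000 in
/-- The Bochner-type inequality `Δ|∂ₜu|² ≥ -A|∂ₜu|⁴` for `J`-holomorphic curves. -/
theorem exists_laplacian_ge {J : V → V →L[ℝ] V} (hJ : ContDiff ℝ (⊤ : ℕ∞) J)
    (hJ2 : ∀ x v, J x (J x v) = -v) {K : Set V} (hK : IsCompact K) :
    ∃ A : ℝ, 0 < A ∧ ∀ (u : ℂ → V) (Ω : Set ℂ), IsOpen Ω → IsHolOn J u Ω → MapsTo u Ω K →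
      ∀ z ∈ Ω, -(A * (‖fderiv ℝ u z I‖ ^ 2) ^ 2) ≤
        fderiv ℝ (fderiv ℝ (fun z => ‖fderiv ℝ u z I‖ ^ 2)) z 1 1
        + fderiv ℝ (fderiv ℝ (fun z => ‖fderiv ℝ u z I‖ ^ 2)) z I I := by
  have hDJ : ContDiff ℝ (⊤ : ℕ∞) (fderiv ℝ J) := hJ.fderiv_right (by simp)
  have hDDJ : ContDiff ℝ (⊤ : ℕ∞) (fderiv ℝ (fderiv ℝ J)) := hDJ.fderiv_right (by simp)
  obtain ⟨c₀, hc₀⟩ := hK.exists_bound_of_continuousOn hJ.continuous.continuousOn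
  obtain ⟨c₁, hc₁⟩ := hK.exists_bound_of_continuousOn hDJ.continuous.continuousOn
  obtain ⟨c₂, hc₂⟩ := hK.exists_bound_of_continuousOn hDDJ.continuous.continuousOn
  set c := max 1 (max c₀ (max c₁ c₂)) with hc
  have hc1 : 1 ≤ c := le_max_left _ _
  have hcpos : 0 < c := by linarith
  refine ⟨18 * c ^ 4 + 8 * c ^ 2, by positivity, fun u Ω hΩ hu hmaps z hz => ?_⟩
  have b0 : ‖J (u z)‖ ≤ c := (hc₀ _ (hmaps hz)).trans (by simp [hc])
  have b1 : ‖fderiv ℝ J (u z)‖ ≤ c := (hc₁ _ (hmaps hz)).trans (by simp [hc])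
  have b2 : ‖fderiv ℝ (fderiv ℝ J) (u z)‖ ≤ c := (hc₂ _ (hmaps hz)).trans (by simp [hc])
  set W : ℂ → V := fun z => fderiv ℝ u z I with hWdef
  have hW : ContDiffOn ℝ (⊤ : ℕ∞) W Ω := contDiffOn_fderiv_apply hΩ hu.contDiffOn I
  set X : ℂ → V := fun z => fderiv ℝ W z I with hXdef
  have hX : ContDiffOn ℝ (⊤ : ℕ∞) X Ω := contDiffOn_fderiv_apply hΩ hW I
  set Y : ℂ → V := fun z => fderiv ℝ W z 1 with hYdef
  have hYeq : ∀ w ∈ Ω, Y w = -(J (u w) (X w) + fderiv ℝ J (u w) (W w) (W w)) := fun w hw =>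
    hu.linearized hΩ hJ hw
  have hYd : ∀ h, fderiv ℝ Y z h = -(J (u z) (fderiv ℝ X z h)
      + fderiv ℝ J (u z) (fderiv ℝ u z h) (X z)
      + (fderiv ℝ J (u z) (W z) (fderiv ℝ W z h)
      + (fderiv ℝ (fderiv ℝ J) (u z) (fderiv ℝ u z h) (W z) (W z)
      + fderiv ℝ J (u z) (fderiv ℝ W z h) (W z)))) := by
    intro h
    have heq : Y =ᶠ[𝓝 z] fun w => -(J (u w) (X w) + fderiv ℝ J (u w) (W w) (W w)) := by
      filter_upwards [hΩ.mem_nhds hz] with w hw using hYeq w hw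
    have hud := hasFDerivAt_of_smooth hΩ hu.contDiffOn hz
    have hWd := hasFDerivAt_of_smooth hΩ hW hz
    have hXd := hasFDerivAt_of_smooth hΩ hX hz
    have hJd : HasFDerivAt J (fderiv ℝ J (u z)) (u z) :=
      (hJ.differentiable (by simp) _).hasFDerivAt
    have hDJd : HasFDerivAt (fderiv ℝ J) (fderiv ℝ (fderiv ℝ J) (u z)) (u z) :=
      (hDJ.differentiable (by simp) _).hasFDerivAt
    have h1 := (((hJd.comp z hud).clm_apply hXd).add
      (((hDJd.comp z hud).clm_apply hWd).clm_apply hWd)).neg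
    have h2 := congrArg (· h) (h1.congr_of_eventuallyEq heq).fderiv
    simp only [Function.comp_def] at h2
    simp only [_root_.neg_apply, _root_.add_apply, ContinuousLinearMap.comp_apply,
      ContinuousLinearMap.flip_apply] at h2
    rw [h2]
    abel
  have hsymm : fderiv ℝ X z 1 = fderiv ℝ Y z I := fderiv_comm hΩ hW hz I 1
  have hlap : fderiv ℝ Y z 1 + fderiv ℝ X z I =
      -(fderiv ℝ J (u z) (fderiv ℝ u z 1) (X z)) + J (u z) (fderiv ℝ J (u z) (W z) (X z))
      + J (u z) (fderiv ℝ J (u z) (W z) (X z))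
      + J (u z) (fderiv ℝ (fderiv ℝ J) (u z) (W z) (W z) (W z))
      + J (u z) (fderiv ℝ J (u z) (X z) (W z))
      - fderiv ℝ J (u z) (W z) (Y z)
      - fderiv ℝ (fderiv ℝ J) (u z) (fderiv ℝ u z 1) (W z) (W z)
      - fderiv ℝ J (u z) (Y z) (W z) := by
    rw [hYd 1, hsymm, hYd I]
    simp only [map_add, map_neg, hJ2]
    abel
  set w := ‖W z‖
  set x := ‖X z‖
  have hw0 : 0 ≤ w := norm_nonneg _
  have hx0 : 0 ≤ x := norm_nonneg _
  have n0 : ∀ v, ‖J (u z) v‖ ≤ c * ‖v‖ := fun v => (J (u z)).le_of_opNorm_le b0 v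
  have n1 : ∀ a b, ‖fderiv ℝ J (u z) a b‖ ≤ c * ‖a‖ * ‖b‖ := fun a b =>
    ((fderiv ℝ J (u z) a).le_opNorm b).trans
      (by gcongr; exact (fderiv ℝ J (u z)).le_of_opNorm_le b1 a)
  have n2 : ∀ a b d, ‖fderiv ℝ (fderiv ℝ J) (u z) a b d‖ ≤ c * ‖a‖ * ‖b‖ * ‖d‖ := fun a b d => by
    refine ((fderiv ℝ (fderiv ℝ J) (u z) a b).le_opNorm d).trans ?_
    gcongr
    refine ((fderiv ℝ (fderiv ℝ J) (u z) a).le_opNorm b).trans ?_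
    gcongr
    exact (fderiv ℝ (fderiv ℝ J) (u z)).le_of_opNorm_le b2 a
  have nus : ‖fderiv ℝ u z 1‖ ≤ c * w := by
    rw [hu.fderiv_one hz, norm_neg]; exact n0 _
  have nY : ‖Y z‖ ≤ c * x + c * w * w := by
    rw [hYeq z hz, norm_neg]
    exact (norm_add_le _ _).trans (add_le_add (n0 _) (n1 _ _))
  have nlap : ‖fderiv ℝ Y z 1 + fderiv ℝ X z I‖ ≤ c ^ 2 * (6 * (w * x) + 4 * w ^ 3) := by
    have t1 : ‖fderiv ℝ J (u z) (fderiv ℝ u z 1) (X z)‖ ≤ c * (c * w) * x :=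
      (n1 _ _).trans (by gcongr)
    have t2 : ‖J (u z) (fderiv ℝ J (u z) (W z) (X z))‖ ≤ c * (c * w * x) :=
      (n0 _).trans (by gcongr; exact n1 _ _)
    have t3 : ‖J (u z) (fderiv ℝ (fderiv ℝ J) (u z) (W z) (W z) (W z))‖ ≤ c * (c * w * w * w) :=
      (n0 _).trans (by gcongr; exact n2 _ _ _)
    have t4 : ‖J (u z) (fderiv ℝ J (u z) (X z) (W z))‖ ≤ c * (c * x * w) :=
      (n0 _).trans (by gcongr; exact n1 _ _)
    have t5 : ‖fderiv ℝ J (u z) (W z) (Y z)‖ ≤ c * w * (c * x + c * w * w) :=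
      (n1 _ _).trans (by gcongr)
    have t6 : ‖fderiv ℝ (fderiv ℝ J) (u z) (fderiv ℝ u z 1) (W z) (W z)‖ ≤ c * (c * w) * w * w :=
      (n2 _ _ _).trans (by gcongr)
    have t7 : ‖fderiv ℝ J (u z) (Y z) (W z)‖ ≤ c * (c * x + c * w * w) * w :=
      (n1 _ _).trans (by gcongr)
    rw [hlap]
    refine (norm_sub_le_of_le (norm_sub_le_of_le (norm_sub_le_of_le (norm_add_le_of_le
      (norm_add_le_of_le (norm_add_le_of_le (norm_add_le_of_le ((norm_neg _).trans_le t1) t2) t2)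
        t3) t4) t5) t6) t7).trans (le_of_eq ?_)
    ring
  rw [hessian_norm_sq hΩ hW hz, hessian_norm_sq hΩ hW hz]
  have hin : -(w * (c ^ 2 * (6 * (w * x) + 4 * w ^ 3))) ≤
      inner ℝ (W z) (fderiv ℝ Y z 1) + inner ℝ (W z) (fderiv ℝ X z I) := by
    rw [← inner_add_right]
    have := abs_real_inner_le_norm (W z) (fderiv ℝ Y z 1 + fderiv ℝ X z I)
    have h2 : w * ‖fderiv ℝ Y z 1 + fderiv ℝ X z I‖ ≤
      w * (c ^ 2 * (6 * (w * x) + 4 * w ^ 3)) := by gcongr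
    linarith [(abs_le.1 this).1]
  have hY0 : 0 ≤ ‖Y z‖ ^ 2 := sq_nonneg _
  have hfin : 0 ≤ (x - 3 * c ^ 2 * w ^ 2) ^ 2 := sq_nonneg _
  change -((18 * c ^ 4 + 8 * c ^ 2) * (w ^ 2) ^ 2) ≤
    2 * (‖Y z‖ ^ 2 + inner ℝ (W z) (fderiv ℝ Y z 1)) + 2 * (x ^ 2 + inner ℝ (W z) (fderiv ℝ X z I))
  nlinarith

end Laplace

section Cylinder

variable {V : Type*} [NormedAddCommGroup V] [NormedSpace ℝ V]

/-- The open left half-plane, universal cover of the punctured disc. -/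
def leftHalfPlane : Set ℂ := {ζ | ζ.re < 0}

theorem isOpen_leftHalfPlane : IsOpen leftHalfPlane := isOpen_lt continuous_re continuous_const

theorem mem_leftHalfPlane {s : ℝ} (hs : s < 0) (t : ℝ) : (s + t * I : ℂ) ∈ leftHalfPlane := by
  simpa [leftHalfPlane] using hs

theorem hasDerivAt_re_line {F : ℂ → V} (hF : ContDiffOn ℝ (⊤ : ℕ∞) F leftHalfPlane) {s : ℝ}
    (hs : s < 0) (t : ℝ) :
    HasDerivAt (fun s : ℝ => F (s + t * I)) (fderiv ℝ F (s + t * I) 1) s := by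
  have h1 : HasDerivAt (fun s : ℝ => (s + t * I : ℂ)) 1 s :=
    (ofRealCLM.hasDerivAt (x := s)).add_const (t * I : ℂ)
  exact (hasFDerivAt_of_smooth isOpen_leftHalfPlane hF (mem_leftHalfPlane hs t)).comp_hasDerivAt s h1

theorem hasDerivAt_im_line {F : ℂ → V} (hF : ContDiffOn ℝ (⊤ : ℕ∞) F leftHalfPlane) {s : ℝ}
    (hs : s < 0) (t : ℝ) :
    HasDerivAt (fun t : ℝ => F (s + t * I)) (fderiv ℝ F (s + t * I) I) t := by
  have h1 : HasDerivAt (fun t : ℝ => (s + t * I : ℂ)) I t := by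
    simpa using ((ofRealCLM.hasDerivAt (x := t)).mul_const I).const_add (s : ℂ)
  exact (hasFDerivAt_of_smooth isOpen_leftHalfPlane hF (mem_leftHalfPlane hs t)).comp_hasDerivAt t h1

theorem continuousOn_cylinder {X : Type*} [TopologicalSpace X] {F : ℂ → X}
    (hF : ContinuousOn F leftHalfPlane) :
    ContinuousOn (fun p : ℝ × ℝ => F (p.1 + p.2 * I)) (Iio 0 ×ˢ univ) := by
  refine hF.comp (by fun_prop) ?_
  rintro ⟨s, t⟩ ⟨hs, -⟩
  exact mem_leftHalfPlane hs t

theorem continuous_im_line {X : Type*} [TopologicalSpace X] {F : ℂ → X}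
    (hF : ContinuousOn F leftHalfPlane) {s : ℝ} (hs : s < 0) :
    Continuous fun t : ℝ => F (s + t * I) :=
  hF.comp_continuous (by fun_prop) (mem_leftHalfPlane hs)

theorem fderiv_periodic {v : ℂ → V} (hper : ∀ ζ, v (ζ + 2 * π * I) = v ζ) (ζ : ℂ) :
    fderiv ℝ v (ζ + 2 * π * I) = fderiv ℝ v ζ := by
  rw [← fderiv_comp_add_right]
  simp_rw [hper]

theorem periodic_im_line {X : Type*} {F : ℂ → X} (hper : ∀ ζ, F (ζ + 2 * π * I) = F ζ) (s : ℝ) :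
    Function.Periodic (fun t : ℝ => F (s + t * I)) (2 * π) := fun t => by
  have := hper (s + t * I)
  change F (s + (t + 2 * π : ℝ) * I) = F (s + t * I)
  rw [← this]
  push_cast
  congr 1
  ring

/-- First variation of the symplectic action of the loops `t ↦ v (s + it)`. -/
theorem hasDerivAt_action {v : ℂ → V} (hv : ContDiffOn ℝ (⊤ : ℕ∞) v leftHalfPlane)
    (hper : ∀ ζ, v (ζ + 2 * π * I) = v ζ) (ω : V →L[ℝ] V →L[ℝ] ℝ) (hω : ∀ a b, ω a b = -ω b a)
    {s : ℝ} (hs : s < 0) :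
    HasDerivAt (fun s : ℝ => ∫ t in (0)..(2 * π), ω (v (s + t * I)) (fderiv ℝ v (s + t * I) I))
      (2 * ∫ t in (0)..(2 * π), ω (fderiv ℝ v (s + t * I) 1) (fderiv ℝ v (s + t * I) I)) s := by
  set S : ℂ → V := fun ζ => fderiv ℝ v ζ 1 with hS
  set W : ℂ → V := fun ζ => fderiv ℝ v ζ I with hW
  have hSs : ContDiffOn ℝ (⊤ : ℕ∞) S leftHalfPlane :=
    contDiffOn_fderiv_apply isOpen_leftHalfPlane hv 1
  have hWs : ContDiffOn ℝ (⊤ : ℕ∞) W leftHalfPlane :=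
    contDiffOn_fderiv_apply isOpen_leftHalfPlane hv I
  have hW1 : ContDiffOn ℝ (⊤ : ℕ∞) (fun ζ => fderiv ℝ W ζ 1) leftHalfPlane :=
    contDiffOn_fderiv_apply isOpen_leftHalfPlane hWs 1
  have hSc : Continuous fun t : ℝ => S (s + t * I) := continuous_im_line hSs.continuousOn hs
  have hWc : Continuous fun t : ℝ => W (s + t * I) := continuous_im_line hWs.continuousOn hs
  have hvc : Continuous fun t : ℝ => v (s + t * I) := continuous_im_line hv.continuousOn hs
  have hW1c : Continuous fun t : ℝ => fderiv ℝ W (s + t * I) 1 :=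
    continuous_im_line hW1.continuousOn hs
  have hd := hasDerivAt_intervalIntegral (U := Iio (0 : ℝ)) (s₀ := s)
    (g := fun s t => ω (v (s + t * I)) (W (s + t * I)))
    (g' := fun s t => ω (v (s + t * I)) (fderiv ℝ W (s + t * I) 1)
      + ω (S (s + t * I)) (W (s + t * I))) isOpen_Iio
    (fun s hs t => by
      have h1 := hasDerivAt_re_line hv hs t
      have h2 := hasDerivAt_re_line hWs hs t
      have h3 := (ω.hasFDerivAt.comp_hasDerivAt s h1).clm_apply h2
      rw [add_comm]
      exact h3)
    (fun s hs => (ω.continuous.comp (continuous_im_line hv.continuousOn hs)).clm_apply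
      (continuous_im_line hWs.continuousOn hs))
    (((ω.continuous.comp_continuousOn (continuousOn_cylinder hv.continuousOn)).clm_apply
        (continuousOn_cylinder hW1.continuousOn)).add
      ((ω.continuous.comp_continuousOn (continuousOn_cylinder hSs.continuousOn)).clm_apply
        (continuousOn_cylinder hWs.continuousOn))) hs 0 (2 * π)
  refine hd.congr_deriv ?_
  have hb : ∫ t in (0)..(2 * π), (ω (W (s + t * I)) (S (s + t * I))
      + ω (v (s + t * I)) (fderiv ℝ W (s + t * I) 1)) = 0 := by
    rw [intervalIntegral.integral_eq_sub_of_hasDerivAt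
      (f := fun t : ℝ => ω (v (s + t * I)) (S (s + t * I)))]
    · have h0 := periodic_im_line hper s 0
      have h1 : S (s + ((2 * π : ℝ) : ℂ) * I) = S (s + ((0 : ℝ) : ℂ) * I) := by
        have := fderiv_periodic hper (s : ℂ)
        simp only [hS]
        push_cast
        rw [this]; simp
      simp only [zero_add] at h0
      rw [h0, h1, sub_self]
    · intro t _
      have h1 := hasDerivAt_im_line hv hs t
      have h2 := hasDerivAt_im_line hSs hs t
      have h3 := (ω.hasFDerivAt.comp_hasDerivAt t h1).clm_apply h2
      rw [fderiv_comm isOpen_leftHalfPlane hv (mem_leftHalfPlane hs t) 1 I] at h3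
      exact h3
    · exact (((ω.continuous.comp hWc).clm_apply hSc).add
        ((ω.continuous.comp hvc).clm_apply hW1c)).intervalIntegrable _ _
  have i1 : IntervalIntegrable (fun t : ℝ => ω (S (s + t * I)) (W (s + t * I))) volume 0 (2 * π) :=
    ((ω.continuous.comp hSc).clm_apply hWc).intervalIntegrable _ _
  refine ((sub_zero _).symm.trans (congrArg (_ - ·) hb.symm)).trans ?_
  rw [← intervalIntegral.integral_sub, ← intervalIntegral.integral_const_mul]
  · congr 1
    ext t
    rw [hω (W _) (S _)]
    ring
  · exact (((ω.continuous.comp hvc).clm_apply hW1c).add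
      ((ω.continuous.comp hSc).clm_apply hWc)).intervalIntegrable _ _
  · exact (((ω.continuous.comp hWc).clm_apply hSc).add
        ((ω.continuous.comp hvc).clm_apply hW1c)).intervalIntegrable _ _

theorem continuousOn_circle_integral {f : ℂ → ℝ} (hf : ContinuousOn f leftHalfPlane) (a b : ℝ) :
    ContinuousOn (fun s : ℝ => ∫ t in a..b, f (s + t * I)) (Iio 0) := by
  rw [continuousOn_iff_continuous_domRestrict]
  refine intervalIntegral.continuous_parametric_intervalIntegral_of_continuous'
    (f := fun (s : Iio (0 : ℝ)) (t : ℝ) => f ((s : ℝ) + t * I)) ?_ a b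
  exact (continuousOn_cylinder hf).comp_continuous
    (f := fun p : Iio (0 : ℝ) × ℝ => ((p.1 : ℝ), p.2)) (by fun_prop) (fun p => ⟨p.1.2, mem_univ _⟩)

theorem integral_ball_le {f : ℂ → ℝ} (hf : ContinuousOn f leftHalfPlane) (hf0 : ∀ ζ, 0 ≤ f ζ)
    (hper : ∀ ζ, f (ζ + 2 * π * I) = f ζ) {ζ : ℂ} (hζ : ζ.re < -1) :
    ∫ z in ball ζ 1, f z ≤
      ∫ s in (ζ.re - 1)..(ζ.re + 1), ∫ t in (0)..(2 * π), f (s + t * I) := by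
  set Q : Set (ℝ × ℝ) := Icc (ζ.re - 1) (ζ.re + 1) ×ˢ Icc (ζ.im - π) (ζ.im + π) with hQ
  have hQs : Q ⊆ Iio 0 ×ˢ univ := fun p hp => ⟨lt_of_le_of_lt hp.1.2 (by linarith), mem_univ _⟩
  have hcont : ContinuousOn (fun p : ℝ × ℝ => f (p.1 + p.2 * I)) Q :=
    (continuousOn_cylinder hf).mono hQs
  have hint : IntegrableOn (fun p : ℝ × ℝ => f (p.1 + p.2 * I)) Q (volume.prod volume) :=
    hcont.integrableOn_compact (isCompact_Icc.prod isCompact_Icc)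
  have h1 : ∫ z in ball ζ 1, f z = ∫ p in equivRealProd.symm ⁻¹' ball ζ 1,
      f (p.1 + p.2 * I) ∂(volume.prod volume) :=
    (volume_preserving_equiv_real_prod.symm.setIntegral_preimage_emb
      (measurableEquivRealProd.symm.measurableEmbedding) f (ball ζ 1)).symm.trans (by
        congr 1
        ext p
        exact congrArg f (equivRealProd_symm_apply p))
  have hsub : equivRealProd.symm ⁻¹' ball ζ 1 ⊆ Q := by
    rintro ⟨x, y⟩ hp
    have hp' : ‖(⟨x, y⟩ : ℂ) - ζ‖ < 1 := by
      have := mem_ball_iff_norm.1 hp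
      exact this
    have hre := (abs_re_le_norm _).trans_lt hp'
    have him := (abs_im_le_norm _).trans_lt hp'
    simp only [sub_re, sub_im] at hre him
    rw [abs_lt] at hre him
    have := Real.pi_gt_three
    exact ⟨⟨by linarith, by linarith⟩, by constructor <;> dsimp only <;> linarith⟩
  rw [h1]
  refine (setIntegral_mono_set hint (Eventually.of_forall fun p => hf0 _)
    hsub.eventuallyLE).trans (le_of_eq ?_)
  rw [hQ, setIntegral_prod _ hint, integral_Icc_eq_integral_Ioc,
    ← intervalIntegral.integral_of_le (by linarith)]
  congr 1
  ext s
  rw [integral_Icc_eq_integral_Ioc, ← intervalIntegral.integral_of_le (by linarith [Real.pi_pos])]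
  have := (periodic_im_line hper s).intervalIntegral_add_eq (ζ.im - π) 0
  rw [zero_add, show ζ.im - π + 2 * π = ζ.im + π by ring] at this
  exact this

/-- Pointwise exponential decay of an energy density controlled by a decaying action. -/
theorem exists_le_exp_of_action {f : ℂ → ℝ} {a a' : ℝ → ℝ} {A c D μ s₁ : ℝ}
    (hf : ContDiffOn ℝ 2 f leftHalfPlane) (hf0 : ∀ ζ, 0 ≤ f ζ)
    (hper : ∀ ζ, f (ζ + 2 * π * I) = f ζ) (hA : 0 < A)
    (hL : ∀ z ∈ leftHalfPlane, -(A * f z ^ 2) ≤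
      fderiv ℝ (fderiv ℝ f) z 1 1 + fderiv ℝ (fderiv ℝ f) z I I)
    (hc : 0 < c) (hμ : 0 < μ) (hs₁ : s₁ < 0) (ha : ∀ s ≤ s₁, HasDerivAt a (a' s) s)
    (haf : ∀ s ≤ s₁, c * ∫ t in (0)..(2 * π), f (s + t * I) ≤ a' s)
    (ha0 : ∀ s ≤ s₁, 0 ≤ a s) (haD : ∀ s ≤ s₁, a s ≤ D * Real.exp (μ * s)) :
    ∃ C s₂ : ℝ, s₂ < 0 ∧ 0 ≤ C ∧ ∀ ζ : ℂ, ζ.re ≤ s₂ → f ζ ≤ C * Real.exp (μ * ζ.re) := by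
  have hD : 0 ≤ D := by
    have := (ha0 s₁ le_rfl).trans (haD s₁ le_rfl)
    exact nonneg_of_mul_nonneg_left this (Real.exp_pos _)
  have htend : Tendsto (fun s => A * (D * Real.exp μ / c * Real.exp (μ * s))) atBot (𝓝 0) := by
    have : Tendsto (fun s => Real.exp (μ * s)) atBot (𝓝 0) :=
      Real.tendsto_exp_atBot.comp (tendsto_id.const_mul_atBot hμ)
    simpa using (this.const_mul (D * Real.exp μ / c)).const_mul A
  obtain ⟨s₃, hs₃⟩ := (htend.eventually (gt_mem_nhds (by norm_num : (0 : ℝ) < 1 / 4))).exists_forall_of_atBot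
  refine ⟨8 * (D * Real.exp μ / c), min s₃ (s₁ - 2), (min_le_right _ _).trans_lt (by linarith),
    by positivity, fun ζ hζ => ?_⟩
  have hζ1 : ζ.re ≤ s₁ - 2 := hζ.trans (min_le_right _ _)
  have hball : ball ζ 2 ⊆ leftHalfPlane := fun w hw => by
    have := (abs_re_le_norm _).trans_lt (mem_ball_iff_norm.1 hw)
    rw [sub_re, abs_lt] at this
    change w.re < 0
    linarith
  have hE : ∫ z in ball ζ 1, f z ≤ D * Real.exp μ / c * Real.exp (μ * ζ.re) := by
    refine (integral_ball_le hf.continuousOn hf0 hper (by linarith)).trans ?_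
    have hicc : Icc (ζ.re - 1) (ζ.re + 1) ⊆ Iio 0 := fun s hs => lt_of_le_of_lt hs.2 (by linarith)
    have h1 := intervalIntegral.integral_le_sub_of_hasDeriv_right_of_le
      (g := a) (g' := a') (φ := fun s => c * ∫ t in (0)..(2 * π), f (s + t * I))
      (a := ζ.re - 1) (b := ζ.re + 1) (by linarith)
      (fun s hs => (ha s (by linarith [hs.2])).continuousAt.continuousWithinAt)
      (fun s hs => (ha s (by linarith [hs.2])).hasDerivWithinAt)
      ((continuousOn_const.mul ((continuousOn_circle_integral hf.continuousOn _ _).mono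
        hicc)).integrableOn_Icc) (fun s hs => haf s (by linarith [hs.2]))
    rw [intervalIntegral.integral_const_mul] at h1
    have h2 := ha0 (ζ.re - 1) (by linarith)
    have h3 := haD (ζ.re + 1) (by linarith)
    rw [mul_add, mul_one, Real.exp_add] at h3
    rw [div_mul_eq_mul_div, le_div_iff₀ hc]
    linarith
  have h := heinz (R := 2) (r := 1) (A := A) (z₀ := ζ) hA (hf.mono hball) (fun z _ => hf0 z)
    (fun z hz => hL z (hball hz)) one_pos (by norm_num) hE (hs₃ _ (hζ.trans (min_le_left _ _)))
  linarith

end Cylinder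

section Decay

theorem sq_integral_le {g : ℝ → ℝ} (hg : Continuous g) :
    (∫ t in (0)..(2 * π), g t) ^ 2 ≤ 2 * π * ∫ t in (0)..(2 * π), g t ^ 2 := by
  set S := ∫ t in (0)..(2 * π), g t with hS
  have h0 : 0 ≤ ∫ t in (0)..(2 * π), (2 * π * g t - S) ^ 2 :=
    intervalIntegral.integral_nonneg (by positivity) fun t _ => sq_nonneg _
  have h1 : ∫ t in (0)..(2 * π), (2 * π * g t - S) ^ 2 =
      (2 * π) ^ 2 * (∫ t in (0)..(2 * π), g t ^ 2) - 2 * (2 * π) * S * S + 2 * π * S ^ 2 := by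
    have : (fun t => (2 * π * g t - S) ^ 2) =
        fun t => (2 * π) ^ 2 * g t ^ 2 - 2 * (2 * π) * S * g t + S ^ 2 := by
      ext t; ring
    rw [this, intervalIntegral.integral_add, intervalIntegral.integral_sub,
      intervalIntegral.integral_const_mul, intervalIntegral.integral_const_mul,
      intervalIntegral.integral_const, sub_zero, smul_eq_mul]
    all_goals exact Continuous.intervalIntegrable (by fun_prop) _ _
  rw [h1] at h0
  have h2 : 0 ≤ 2 * π * (2 * π * (∫ t in (0)..(2 * π), g t ^ 2) - S ^ 2) := by linarith
  have h3 := nonneg_of_mul_nonneg_right h2 (by positivity)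
  linarith

variable {V : Type*} [NormedAddCommGroup V] [InnerProductSpace ℝ V]

/-- The action of a bounded curve is nonnegative as soon as its derivative controls the energy. -/
theorem action_nonneg {v : ℂ → V} (hv : ContDiffOn ℝ (⊤ : ℕ∞) v leftHalfPlane)
    (hper : ∀ ζ, v (ζ + 2 * π * I) = v ζ) (ω : V →L[ℝ] V →L[ℝ] ℝ) (hω : ∀ a b, ω a b = -ω b a)
    {B d s₁ : ℝ} (hB : ∀ ζ ∈ leftHalfPlane, ‖v ζ‖ ≤ B) (hd : 0 < d) (hs₁ : s₁ ≤ 0)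
    (h : ∀ s < s₁, d * ∫ t in (0)..(2 * π), ‖fderiv ℝ v (s + t * I) I‖ ^ 2 ≤
      2 * ∫ t in (0)..(2 * π), ω (fderiv ℝ v (s + t * I) 1) (fderiv ℝ v (s + t * I) I)) :
    ∀ s < s₁, 0 ≤ ∫ t in (0)..(2 * π), ω (v (s + t * I)) (fderiv ℝ v (s + t * I) I) := by
  set a : ℝ → ℝ := fun s => ∫ t in (0)..(2 * π), ω (v (s + t * I)) (fderiv ℝ v (s + t * I) I)
  set a' : ℝ → ℝ := fun s =>
    2 * ∫ t in (0)..(2 * π), ω (fderiv ℝ v (s + t * I) 1) (fderiv ℝ v (s + t * I) I)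
  have ha : ∀ s < 0, HasDerivAt a (a' s) s := fun s hs => hasDerivAt_action hv hper ω hω hs
  have hB0 : 0 ≤ B := (norm_nonneg _).trans (hB ((-1 : ℝ) + (0 : ℝ) * I)
    (mem_leftHalfPlane (by norm_num) 0))
  have hsq : ∀ s < s₁, a s ^ 2 ≤ (2 * π * (‖ω‖ * B) ^ 2 / d + 1) * a' s := by
    intro s hs
    have hs0 : s < 0 := hs.trans_le hs₁
    have hWc : Continuous fun t : ℝ => fderiv ℝ v (s + t * I) I := continuous_im_line
      (contDiffOn_fderiv_apply isOpen_leftHalfPlane hv I).continuousOn hs0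
    have hvc : Continuous fun t : ℝ => v (s + t * I) := continuous_im_line hv.continuousOn hs0
    have hg : Continuous fun t : ℝ => ω (v (s + t * I)) (fderiv ℝ v (s + t * I) I) :=
      (ω.continuous.comp hvc).clm_apply hWc
    have hE0 : 0 ≤ ∫ t in (0)..(2 * π), ‖fderiv ℝ v (s + t * I) I‖ ^ 2 :=
      intervalIntegral.integral_nonneg (by positivity) fun t _ => sq_nonneg _
    have h1 := sq_integral_le hg
    have h2 : ∫ t in (0)..(2 * π), (ω (v (s + t * I)) (fderiv ℝ v (s + t * I) I)) ^ 2 ≤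
        (‖ω‖ * B) ^ 2 * ∫ t in (0)..(2 * π), ‖fderiv ℝ v (s + t * I) I‖ ^ 2 := by
      rw [← intervalIntegral.integral_const_mul]
      refine intervalIntegral.integral_mono_on (by positivity)
        ((hg.pow 2).intervalIntegrable _ _)
        (((hWc.norm.pow 2).const_mul _).intervalIntegrable _ _) fun t _ => ?_
      rw [← mul_pow, ← sq_abs]
      refine pow_le_pow_left₀ (abs_nonneg _) ?_ 2
      refine (ω.le_opNorm₂ _ _).trans ?_
      gcongr
      exact hB _ (mem_leftHalfPlane hs0 t)
    have h3 := h s hs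
    have h4 : 0 ≤ a' s := (mul_nonneg hd.le hE0).trans h3
    have h5 : (∫ t in (0)..(2 * π), ‖fderiv ℝ v (s + t * I) I‖ ^ 2) ≤ a' s / d := by
      rw [le_div_iff₀ hd]; linarith
    calc a s ^ 2 ≤ 2 * π * ((‖ω‖ * B) ^ 2 * (a' s / d)) := by
          refine h1.trans ?_
          gcongr
          exact h2.trans (by gcongr)
      _ = 2 * π * (‖ω‖ * B) ^ 2 / d * a' s := by ring
      _ ≤ _ := by linarith
  have key := nonneg_of_sq_le_deriv (C := 2 * π * (‖ω‖ * B) ^ 2 / d + 1) (by positivity)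
    (a := fun s => a (s + s₁)) (a' := fun s => a' (s + s₁))
    (fun s hs => (ha (s + s₁) (by linarith)).comp_add_const s s₁)
    (fun s hs => hsq (s + s₁) (by linarith))
  intro s hs
  have := key (s - s₁) (by linarith)
  rwa [sub_add_cancel] at this

variable {J : V → V →L[ℝ] V} {v : ℂ → V} {K : Set V}

/-- The energy density of a holomorphic cylinder is a subsolution of a semilinear equation. -/
theorem exists_energy_density (hJ : ContDiff ℝ (⊤ : ℕ∞) J) (hJ2 : ∀ x v, J x (J x v) = -v)
    (hK : IsCompact K) (hv : IsHolOn J v leftHalfPlane)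
    (hper : ∀ ζ, v (ζ + 2 * π * I) = v ζ) (hmaps : MapsTo v leftHalfPlane K)
    {a a' : ℝ → ℝ} {c D μ s₁ : ℝ}
    (hc : 0 < c) (hμ : 0 < μ) (hs₁ : s₁ < 0) (ha : ∀ s ≤ s₁, HasDerivAt a (a' s) s)
    (haf : ∀ s ≤ s₁, c * ∫ t in (0)..(2 * π), ‖fderiv ℝ v (s + t * I) I‖ ^ 2 ≤ a' s)
    (ha0 : ∀ s ≤ s₁, 0 ≤ a s) (haD : ∀ s ≤ s₁, a s ≤ D * Real.exp (μ * s)) :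
    ∃ C s₂ : ℝ, s₂ < 0 ∧ 0 ≤ C ∧
      ∀ ζ : ℂ, ζ.re ≤ s₂ → ‖fderiv ℝ v ζ I‖ ^ 2 ≤ C * Real.exp (μ * ζ.re) := by
  obtain ⟨A, hA, hL⟩ := exists_laplacian_ge hJ hJ2 hK
  exact exists_le_exp_of_action (f := fun ζ => ‖fderiv ℝ v ζ I‖ ^ 2)
    (((contDiffOn_fderiv_apply isOpen_leftHalfPlane hv.contDiffOn I).norm_sq ℝ).of_le
      (WithTop.coe_le_coe.2 (le_top : (2 : ℕ∞) ≤ ⊤))) (fun _ => sq_nonneg _)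
    (fun ζ => by simp only [fderiv_periodic hper]) hA
    (hL v leftHalfPlane isOpen_leftHalfPlane hv hmaps) hc hμ hs₁ ha haf ha0 haD

theorem action_deriv_eq (hv : IsHolOn J v leftHalfPlane) (ω : V →L[ℝ] V →L[ℝ] ℝ)
    (hω : ∀ a b, ω a b = -ω b a) {ζ : ℂ} (hζ : ζ ∈ leftHalfPlane) :
    ω (fderiv ℝ v ζ 1) (fderiv ℝ v ζ I) = ω (fderiv ℝ v ζ I) (J (v ζ) (fderiv ℝ v ζ I)) := by
  rw [hω, hv.fderiv_one hζ, map_neg, neg_neg]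

theorem continuous_energy_line (hv : ContDiffOn ℝ (⊤ : ℕ∞) v leftHalfPlane) {s : ℝ} (hs : s < 0) :
    Continuous fun t : ℝ => fderiv ℝ v (s + t * I) I := continuous_im_line
  (contDiffOn_fderiv_apply isOpen_leftHalfPlane hv I).continuousOn hs

theorem continuous_action_deriv_line (hv : ContDiffOn ℝ (⊤ : ℕ∞) v leftHalfPlane)
    (ω : V →L[ℝ] V →L[ℝ] ℝ) {s : ℝ} (hs : s < 0) :
    Continuous fun t : ℝ => ω (fderiv ℝ v (s + t * I) 1) (fderiv ℝ v (s + t * I) I) :=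
  (ω.continuous.comp (continuous_im_line
    (contDiffOn_fderiv_apply isOpen_leftHalfPlane hv 1).continuousOn hs)).clm_apply
    (continuous_energy_line hv hs)

/-- Exponential decay of the energy density forces convergence at the end of the cylinder. -/
theorem exists_limit_of_decay (hJ : ContDiff ℝ (⊤ : ℕ∞) J) (hK : IsCompact K)
    (hv : IsHolOn J v leftHalfPlane) (hper : ∀ ζ, v (ζ + 2 * π * I) = v ζ)
    (hmaps : MapsTo v leftHalfPlane K) {μ C s₂ : ℝ} (hμ : 0 < μ) (hs₂ : s₂ < 0) (hC : 0 ≤ C)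
    (hdecay : ∀ ζ : ℂ, ζ.re ≤ s₂ → ‖fderiv ℝ v ζ I‖ ^ 2 ≤ C * Real.exp (μ * ζ.re)) :
    ∃ p ∈ K, ∃ C' : ℝ, 0 ≤ C' ∧ ∀ ζ : ℂ, ζ.re ≤ s₂ → ‖v ζ - p‖ ≤ C' * Real.exp (μ / 2 * ζ.re) := by
  set ν := μ / 2 with hν
  have hνpos : 0 < ν := by positivity
  obtain ⟨c₀, hc₀⟩ := hK.exists_bound_of_continuousOn hJ.continuous.continuousOn
  set k := max 1 c₀
  have hk1 : 1 ≤ k := le_max_left _ _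
  set C₁ := k * √C with hC₁
  have hC₁0 : 0 ≤ C₁ := by positivity
  have hW' : ∀ ζ : ℂ, ζ.re ≤ s₂ → ‖fderiv ℝ v ζ I‖ ≤ √C * Real.exp (ν * ζ.re) := by
    intro ζ hζ
    refine le_of_sq_le_sq ?_ (by positivity)
    rw [mul_pow, Real.sq_sqrt hC, ← Real.exp_nat_mul]
    refine (hdecay ζ hζ).trans (le_of_eq ?_)
    congr 2
    rw [hν]; push_cast; ring
  have hW : ∀ ζ : ℂ, ζ.re ≤ s₂ → ‖fderiv ℝ v ζ I‖ ≤ C₁ * Real.exp (ν * ζ.re) := fun ζ hζ =>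
    (hW' ζ hζ).trans (by
      gcongr
      exact le_mul_of_one_le_left (Real.sqrt_nonneg _) hk1)
  have hS : ∀ ζ : ℂ, ζ.re ≤ s₂ → ‖fderiv ℝ v ζ 1‖ ≤ C₁ * Real.exp (ν * ζ.re) := by
    intro ζ hζ
    have hζ' : ζ ∈ leftHalfPlane := lt_of_le_of_lt hζ hs₂
    rw [hv.fderiv_one hζ', norm_neg, hC₁, mul_assoc]
    exact ((J (v ζ)).le_opNorm _).trans (mul_le_mul ((hc₀ _ (hmaps hζ')).trans (le_max_right _ _))
      (hW' ζ hζ) (norm_nonneg _) (by positivity))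
  have hline : ∀ s s' : ℝ, s ≤ s' → s' ≤ s₂ →
      ‖v (s' + (0 : ℝ) * I) - v (s + (0 : ℝ) * I)‖ ≤ C₁ / ν * Real.exp (ν * s') := by
    intro s s' hss hs'
    have hB : ∀ x : ℝ, HasDerivAt (fun x => C₁ / ν * (Real.exp (ν * x) - Real.exp (ν * s)))
        (C₁ * Real.exp (ν * x)) x := fun x => by
      have := ((((hasDerivAt_id x).const_mul ν).exp).sub_const (Real.exp (ν * s))).const_mul
        (C₁ / ν)
      refine this.congr_deriv ?_
      simp only [id]
      field_simp
    have hd : ∀ x ∈ Icc s s', HasDerivAt (fun x : ℝ => v (x + (0 : ℝ) * I) - v (s + (0 : ℝ) * I))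
        (fderiv ℝ v (x + (0 : ℝ) * I) 1) x := fun x hx =>
      (hasDerivAt_re_line hv.contDiffOn (by linarith [hx.2]) 0).sub_const _
    have := image_norm_le_of_norm_deriv_right_le_deriv_boundary
      (fun x hx => (hd x hx).continuousAt.continuousWithinAt)
      (fun x hx => (hd x ⟨hx.1, hx.2.le⟩).hasDerivWithinAt) (by simp) hB
      (fun x hx => by simpa using hS (x + (0 : ℝ) * I) (by simpa using hx.2.le.trans hs'))
      (right_mem_Icc.2 hss)
    refine this.trans ?_
    gcongr
    linarith [Real.exp_pos (ν * s)]
  have hseq : ∀ n : ℕ, v ((-(n + 1 : ℝ) : ℝ) + (0 : ℝ) * I) ∈ K := fun n =>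
    hmaps (mem_leftHalfPlane (by linarith [n.cast_nonneg (α := ℝ)]) 0)
  obtain ⟨p, hpK, φ, hφ, hp⟩ := hK.tendsto_subseq hseq
  have hp0 : ∀ s : ℝ, s ≤ s₂ → ‖v (s + (0 : ℝ) * I) - p‖ ≤ C₁ / ν * Real.exp (ν * s) := by
    intro s hs
    refine le_of_tendsto ((tendsto_const_nhds.sub hp).norm) ?_
    filter_upwards [hφ.tendsto_atTop.eventually_ge_atTop ⌈-s⌉₊] with n hn
    refine hline _ s ?_ hs
    have h1 : -s ≤ (φ n : ℝ) := (Nat.le_ceil _).trans (by exact_mod_cast hn)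
    linarith
  refine ⟨p, hpK, C₁ * (2 * π) + C₁ / ν, by positivity, fun ζ hζ => ?_⟩
  have hs0 : ζ.re < 0 := hζ.trans_lt hs₂
  obtain ⟨t, ht, hvt⟩ := (periodic_im_line hper ζ.re).exists_mem_Ico₀ Real.two_pi_pos ζ.im
  simp only [re_add_im] at hvt
  have hd : ∀ x ∈ Icc (0 : ℝ) (2 * π), HasDerivWithinAt (fun x : ℝ => v (ζ.re + x * I))
      (fderiv ℝ v (ζ.re + x * I) I) (Icc (0 : ℝ) (2 * π)) x := fun x _ =>
    (hasDerivAt_im_line hv.contDiffOn hs0 x).hasDerivWithinAt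
  have h1 := (convex_Icc (0 : ℝ) (2 * π)).norm_image_sub_le_of_norm_hasDerivWithin_le hd
    (fun x _ => by simpa using hW (ζ.re + x * I) (by simpa using hζ))
    (left_mem_Icc.2 (by positivity)) ⟨ht.1, ht.2.le⟩
  rw [hvt, add_mul]
  refine (norm_sub_le_norm_sub_add_norm_sub _ (v (ζ.re + (0 : ℝ) * I)) _).trans
    (add_le_add (h1.trans ?_) (hp0 _ hζ))
  rw [sub_zero, Real.norm_of_nonneg ht.1]
  calc C₁ * Real.exp (ν * ζ.re) * t ≤ C₁ * Real.exp (ν * ζ.re) * (2 * π) := by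
        gcongr; exact ht.2.le
    _ = _ := by ring

variable [FiniteDimensional ℝ V]

/-- Exponential decay of the energy density at some positive rate. -/
theorem exists_decay (hJ : ContDiff ℝ (⊤ : ℕ∞) J) (hJ2 : ∀ x v, J x (J x v) = -v)
    (hK : IsCompact K) (ω : V →L[ℝ] V →L[ℝ] ℝ) (hω : ∀ a b, ω a b = -ω b a) {c : ℝ} (hc : 0 < c)
    (htame : ∀ x ∈ K, ∀ w, c * ‖w‖ ^ 2 ≤ ω w (J x w)) (hv : IsHolOn J v leftHalfPlane)
    (hper : ∀ ζ, v (ζ + 2 * π * I) = v ζ) (hmaps : MapsTo v leftHalfPlane K) :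
    ∃ μ C s₂ : ℝ, 0 < μ ∧ s₂ < 0 ∧ 0 ≤ C ∧
      ∀ ζ : ℂ, ζ.re ≤ s₂ → ‖fderiv ℝ v ζ I‖ ^ 2 ≤ C * Real.exp (μ * ζ.re) := by
  obtain ⟨B, hB⟩ := hK.exists_bound_of_continuousOn continuousOn_id
  set a : ℝ → ℝ := fun s => ∫ t in (0)..(2 * π), ω (v (s + t * I)) (fderiv ℝ v (s + t * I) I)
  set a' : ℝ → ℝ := fun s =>
    2 * ∫ t in (0)..(2 * π), ω (fderiv ℝ v (s + t * I) 1) (fderiv ℝ v (s + t * I) I)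
  have ha : ∀ s < 0, HasDerivAt a (a' s) s := fun s hs =>
    hasDerivAt_action hv.contDiffOn hper ω hω hs
  have hE : ∀ s : ℝ, s < 0 → 2 * c * ∫ t in (0)..(2 * π), ‖fderiv ℝ v (s + t * I) I‖ ^ 2 ≤ a' s := by
    intro s hs
    rw [mul_assoc, ← intervalIntegral.integral_const_mul]
    refine mul_le_mul_of_nonneg_left (intervalIntegral.integral_mono_on (by positivity)
      ((((continuous_energy_line hv.contDiffOn hs).norm.pow 2).const_mul _).intervalIntegrable _ _)
      ((continuous_action_deriv_line hv.contDiffOn ω hs).intervalIntegrable _ _) fun t _ => ?_)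
      two_pos.le
    rw [action_deriv_eq hv ω hω (mem_leftHalfPlane hs t)]
    exact htame _ (hmaps (mem_leftHalfPlane hs t)) _
  have ha0 : ∀ s : ℝ, s < 0 → 0 ≤ a s := action_nonneg hv.contDiffOn hper ω hω
    (fun ζ hζ => hB _ (hmaps hζ)) (by positivity : 0 < 2 * c) le_rfl hE
  set M := ‖ω‖ + 1 with hM
  have hMpos : 0 < M := by positivity
  have hiso : ∀ s : ℝ, s < 0 → 2 * c / M * a s ≤ a' s := by
    intro s hs
    have h1 := abs_action_le (ContinuousLinearMap.id ℝ V) ω (norm_nonneg ω)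
      (fun a b => by simpa [mul_assoc] using ω.le_opNorm₂ a b)
      (hasDerivAt_im_line hv.contDiffOn hs) (continuous_energy_line hv.contDiffOn hs)
      (by simpa using periodic_im_line hper s 0)
    simp only [ContinuousLinearMap.id_apply] at h1
    have h2 := (le_abs_self _).trans h1
    have hE0 : 0 ≤ ∫ t in (0)..(2 * π), ‖fderiv ℝ v (s + t * I) I‖ ^ 2 :=
      intervalIntegral.integral_nonneg (by positivity) fun t _ => sq_nonneg _
    have h3 : a s ≤ M * ∫ t in (0)..(2 * π), ‖fderiv ℝ v (s + t * I) I‖ ^ 2 :=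
      h2.trans (mul_le_mul_of_nonneg_right (by simp [hM]) hE0)
    refine le_trans ?_ (hE s hs)
    calc 2 * c / M * a s ≤ 2 * c / M *
          (M * ∫ t in (0)..(2 * π), ‖fderiv ℝ v (s + t * I) I‖ ^ 2) := by gcongr
      _ = _ := by rw [← mul_assoc, div_mul_cancel₀ _ hMpos.ne']
  have hexp := le_exp_of_deriv_ge (s₁ := -1) (κ := fun s => 2 * c / M * s)
    (κ' := fun _ => 2 * c / M) (fun s hs => ha s (by linarith))
    (fun s _ => by simpa using (hasDerivAt_id s).const_mul (2 * c / M))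
    (fun s hs => hiso s (by linarith))
  obtain ⟨C, s₂, h⟩ := exists_energy_density hJ hJ2 hK hv hper hmaps (s₁ := -1)
    (D := a (-1) * Real.exp (2 * c / M)) (μ := 2 * c / M)
    (by positivity : 0 < 2 * c) (by positivity) (by norm_num) (fun s hs => ha s (by linarith))
    (fun s hs => hE s (by linarith)) (fun s hs => ha0 s (by linarith)) (fun s hs => by
      refine (hexp s hs).trans (le_of_eq ?_)
      rw [mul_assoc, ← Real.exp_add]
      congr 2
      ring)
  exact ⟨2 * c / M, C, s₂, by positivity, h⟩

end Decay

section SharpDecay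

variable {V : Type*} [NormedAddCommGroup V] [InnerProductSpace ℝ V]

/-- The two-form `⟨Ja, b⟩ - ⟨a, Jb⟩` compatible with a linear complex structure `J`. -/
noncomputable def compatibleForm (J : V →L[ℝ] V) : V →L[ℝ] V →L[ℝ] ℝ :=
  let D : V →L[ℝ] V →L[ℝ] ℝ := (innerSL ℝ).comp J
  D - D.flip

theorem compatibleForm_apply (J : V →L[ℝ] V) (a b : V) :
    compatibleForm J a b = inner ℝ (J a) b - inner ℝ (J b) a := rfl

/-- The graph map `x ↦ (x, Jx)` into the `L²` product. -/
noncomputable def graphL2 (J : V →L[ℝ] V) : V →L[ℝ] WithLp 2 (V × V) :=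
  (WithLp.prodContinuousLinearEquiv 2 ℝ V V).symm.toContinuousLinearMap.comp
    ((ContinuousLinearMap.id ℝ V).prod J)

theorem norm_graphL2_sq (J : V →L[ℝ] V) (x : V) : ‖graphL2 J x‖ ^ 2 = ‖x‖ ^ 2 + ‖J x‖ ^ 2 := by
  rw [WithLp.prod_norm_sq_eq_of_L2]
  rfl

theorem abs_compatibleForm_le (J : V →L[ℝ] V) (a b : V) :
    |compatibleForm J a b| ≤ ‖graphL2 J a‖ * ‖graphL2 J b‖ := by
  refine abs_le_of_sq_le_sq ?_ (by positivity)
  have h1 : |compatibleForm J a b| ≤ ‖J a‖ * ‖b‖ + ‖J b‖ * ‖a‖ := by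
    rw [compatibleForm_apply]
    exact (abs_sub _ _).trans (add_le_add (abs_real_inner_le_norm _ _) (abs_real_inner_le_norm _ _))
  rw [mul_pow, norm_graphL2_sq, norm_graphL2_sq, ← sq_abs]
  have h2 := pow_le_pow_left₀ (abs_nonneg _) h1 2
  nlinarith [sq_nonneg (‖a‖ * ‖b‖ - ‖J a‖ * ‖J b‖)]

variable {J : V → V →L[ℝ] V} {v : ℂ → V} {K : Set V} [FiniteDimensional ℝ V]

theorem exists_sharp_decay (hJ : ContDiff ℝ (⊤ : ℕ∞) J) (hJ2 : ∀ x v, J x (J x v) = -v)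
    (hK : IsCompact K) (hv : IsHolOn J v leftHalfPlane)
    (hper : ∀ ζ, v (ζ + 2 * π * I) = v ζ) (hmaps : MapsTo v leftHalfPlane K)
    {p : V} (hp : p ∈ K) {ν C' s₂ : ℝ} (hν : 0 < ν) (hs₂ : s₂ < 0) (hC' : 0 ≤ C')
    (hlim : ∀ ζ : ℂ, ζ.re ≤ s₂ → ‖v ζ - p‖ ≤ C' * Real.exp (ν * ζ.re)) :
    ∃ C s₃ : ℝ, s₃ < 0 ∧ 0 ≤ C ∧
      ∀ ζ : ℂ, ζ.re ≤ s₃ → ‖fderiv ℝ v ζ I‖ ^ 2 ≤ C * Real.exp (2 * ζ.re) := by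
  obtain ⟨B, hB⟩ := hK.exists_bound_of_continuousOn continuousOn_id
  obtain ⟨L, hL⟩ := (isCompact_closedBall (0 : V) B).exists_bound_of_continuousOn
    (hJ.continuous_fderiv (by simp)).continuousOn
  have hKB : K ⊆ closedBall (0 : V) B := fun x hx => by simpa using hB x hx
  have hL0 : 0 ≤ L := (norm_nonneg _).trans (hL p (hKB hp))
  have hlip : ∀ ζ ∈ leftHalfPlane, ‖J (v ζ) - J p‖ ≤ L * ‖v ζ - p‖ := fun ζ hζ =>
    (convex_closedBall (0 : V) B).norm_image_sub_le_of_norm_fderiv_le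
      (fun x _ => hJ.differentiable (by simp) x) hL (hKB hp) (hKB (hmaps hζ))
  set ω := compatibleForm (J p) with hωdef
  have hω : ∀ a b, ω a b = -ω b a := fun a b => by
    rw [hωdef, compatibleForm_apply, compatibleForm_apply, neg_sub]
  set T := graphL2 (J p)
  set Λ := ‖ω‖ * (L * C') with hΛ
  have hΛ0 : 0 ≤ Λ := by positivity
  have hTle : ∀ w, ‖w‖ ^ 2 ≤ ‖T w‖ ^ 2 := fun w => by
    rw [norm_graphL2_sq]; linarith [sq_nonneg ‖J p w‖]
  have hlow : ∀ ζ : ℂ, ζ.re ≤ s₂ → ∀ w, (1 - Λ * Real.exp (ν * ζ.re)) * ‖T w‖ ^ 2 ≤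
      ω w (J (v ζ) w) := by
    intro ζ hζ w
    have h1 : ω w (J p w) = ‖T w‖ ^ 2 := by
      rw [norm_graphL2_sq, hωdef, compatibleForm_apply, hJ2, inner_neg_left,
        real_inner_self_eq_norm_sq, real_inner_self_eq_norm_sq]
      ring
    have h2 : |ω w ((J (v ζ) - J p) w)| ≤ Λ * Real.exp (ν * ζ.re) * ‖T w‖ ^ 2 := by
      calc |ω w ((J (v ζ) - J p) w)| ≤ ‖ω‖ * ‖w‖ * (L * (C' * Real.exp (ν * ζ.re)) * ‖w‖) := by
            refine (ω.le_opNorm₂ _ _).trans ?_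
            gcongr
            refine ContinuousLinearMap.le_of_opNorm_le _ ?_ _
            refine (hlip ζ (lt_of_le_of_lt hζ hs₂)).trans ?_
            gcongr
            exact hlim ζ hζ
        _ = Λ * Real.exp (ν * ζ.re) * ‖w‖ ^ 2 := by rw [hΛ]; ring
        _ ≤ _ := by gcongr ?_ * ?_; exact hTle w
    rw [_root_.sub_apply, map_sub, h1] at h2
    linarith [(abs_le.1 h2).1]
  set a : ℝ → ℝ := fun s => ∫ t in (0)..(2 * π), ω (v (s + t * I)) (fderiv ℝ v (s + t * I) I)
  set a' : ℝ → ℝ := fun s =>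
    2 * ∫ t in (0)..(2 * π), ω (fderiv ℝ v (s + t * I) 1) (fderiv ℝ v (s + t * I) I)
  have ha : ∀ s : ℝ, s < 0 → HasDerivAt a (a' s) s := fun s hs =>
    hasDerivAt_action hv.contDiffOn hper ω hω hs
  have hTc : ∀ s : ℝ, s < 0 → Continuous fun t : ℝ => ‖T (fderiv ℝ v (s + t * I) I)‖ ^ 2 :=
    fun s hs => (T.continuous.comp (continuous_energy_line hv.contDiffOn hs)).norm.pow 2
  have hE : ∀ s : ℝ, s ≤ s₂ → 2 * (1 - Λ * Real.exp (ν * s)) *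
      ∫ t in (0)..(2 * π), ‖T (fderiv ℝ v (s + t * I) I)‖ ^ 2 ≤ a' s := by
    intro s hs
    have hs0 := hs.trans_lt hs₂
    rw [mul_assoc, ← intervalIntegral.integral_const_mul]
    refine mul_le_mul_of_nonneg_left (intervalIntegral.integral_mono_on (by positivity)
      (((hTc s hs0).const_mul _).intervalIntegrable _ _)
      ((continuous_action_deriv_line hv.contDiffOn ω hs0).intervalIntegrable _ _) fun t _ => ?_)
      two_pos.le
    rw [action_deriv_eq hv ω hω (mem_leftHalfPlane hs0 t)]
    simpa using hlow (s + t * I) (by simpa using hs) (fderiv ℝ v (s + t * I) I)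
  have htend : Tendsto (fun s => Λ * Real.exp (ν * s)) atBot (𝓝 0) := by
    have : Tendsto (fun s => Real.exp (ν * s)) atBot (𝓝 0) :=
      Real.tendsto_exp_atBot.comp (tendsto_id.const_mul_atBot hν)
    simpa using this.const_mul Λ
  obtain ⟨s₄, hs₄⟩ :=
    (htend.eventually (gt_mem_nhds (by norm_num : (0 : ℝ) < 1 / 2))).exists_forall_of_atBot
  set s₁ := min s₂ s₄ with hs₁
  have hs₁0 : s₁ < 0 := (min_le_left _ _).trans_lt hs₂
  have hTE : ∀ s : ℝ, s < 0 → ∫ t in (0)..(2 * π), ‖fderiv ℝ v (s + t * I) I‖ ^ 2 ≤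
      ∫ t in (0)..(2 * π), ‖T (fderiv ℝ v (s + t * I) I)‖ ^ 2 := fun s hs =>
    intervalIntegral.integral_mono_on (by positivity)
      (((continuous_energy_line hv.contDiffOn hs).norm.pow 2).intervalIntegrable _ _)
      ((hTc s hs).intervalIntegrable _ _) fun t _ => hTle _
  have hQ0 : ∀ s : ℝ, 0 ≤ ∫ t in (0)..(2 * π), ‖T (fderiv ℝ v (s + t * I) I)‖ ^ 2 := fun s =>
    intervalIntegral.integral_nonneg (by positivity) fun t _ => sq_nonneg _
  have hE1 : ∀ s : ℝ, s ≤ s₁ → 1 * ∫ t in (0)..(2 * π), ‖fderiv ℝ v (s + t * I) I‖ ^ 2 ≤ a' s := by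
    intro s hs
    have h1 := hs₄ s (hs.trans (min_le_right _ _))
    rw [one_mul]
    refine (hTE s (hs.trans_lt hs₁0)).trans (le_trans ?_ (hE s (hs.trans (min_le_left _ _))))
    exact le_mul_of_one_le_left (hQ0 s) (by linarith)
  have ha0 : ∀ s : ℝ, s < s₁ → 0 ≤ a s := action_nonneg hv.contDiffOn hper ω hω
    (fun ζ hζ => hB _ (hmaps hζ)) one_pos hs₁0.le (fun s hs => hE1 s hs.le)
  have hiso : ∀ s : ℝ, s ≤ s₁ → (2 - 2 * Λ * Real.exp (ν * s)) * a s ≤ a' s := by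
    intro s hs
    have hs0 := hs.trans_lt hs₁0
    have h1 := abs_action_le T ω one_pos.le
      (fun a b => by simpa using abs_compatibleForm_le (J p) a b)
      (hasDerivAt_im_line hv.contDiffOn hs0) (continuous_energy_line hv.contDiffOn hs0)
      (by simpa using periodic_im_line hper s 0)
    rw [one_mul] at h1
    have h2 := (le_abs_self _).trans h1
    have h3 := hs₄ s (hs.trans (min_le_right _ _))
    refine le_trans ?_ (hE s (hs.trans (min_le_left _ _)))
    rw [show 2 - 2 * Λ * Real.exp (ν * s) = 2 * (1 - Λ * Real.exp (ν * s)) by ring]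
    exact mul_le_mul_of_nonneg_left h2 (by linarith)
  have hexp := le_exp_of_deriv_ge (s₁ := s₁ - 1)
    (κ := fun s => 2 * s - 2 * Λ / ν * Real.exp (ν * s))
    (κ' := fun s => 2 - 2 * Λ * Real.exp (ν * s)) (fun s hs => ha s (by linarith))
    (fun s _ => by
      have := ((hasDerivAt_id s).const_mul 2).sub
        (((hasDerivAt_id s).const_mul ν).exp.const_mul (2 * Λ / ν))
      refine this.congr_deriv ?_
      simp only [id]
      field_simp)
    (fun s hs => hiso s (by linarith))
  have ha1 : 0 ≤ a (s₁ - 1) := ha0 _ (by linarith)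
  exact exists_energy_density hJ hJ2 hK hv hper hmaps (s₁ := s₁ - 1)
    (D := a (s₁ - 1) * Real.exp (-(2 * (s₁ - 1) - 2 * Λ / ν * Real.exp (ν * (s₁ - 1))))) (μ := 2)
    one_pos two_pos (by linarith) (fun s hs => ha s (by linarith))
    (fun s hs => hE1 s (by linarith)) (fun s hs => ha0 s (by linarith)) (fun s hs => by
      refine (hexp s hs).trans ?_
      rw [mul_assoc, ← Real.exp_add]
      gcongr
      have : 0 ≤ 2 * Λ / ν * Real.exp (ν * s) := by positivity
      linarith)

end SharpDecay

section Punctured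

variable {V : Type*} [NormedAddCommGroup V] [NormedSpace ℝ V] {J : V → V →L[ℝ] V} {u : ℂ → V}

theorem IsHolOn.fderiv_I_mul {Ω : Set ℂ} (hJ2 : ∀ x v, J x (J x v) = -v) (hu : IsHolOn J u Ω)
    {z : ℂ} (hz : z ∈ Ω) (h : ℂ) : fderiv ℝ u z (I * h) = J (u z) (fderiv ℝ u z h) := by
  have e1 : I * h = (-h.im) • (1 : ℂ) + h.re • I := by apply Complex.ext <;> simp
  have e2 : h = h.re • (1 : ℂ) + h.im • I := by apply Complex.ext <;> simp
  conv_rhs => rw [e2]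
  rw [e1]
  simp only [map_add, map_smul, hu.fderiv_one hz, map_neg, hJ2]
  simp only [smul_neg, neg_smul, neg_neg]
  abel

/-- Polar coordinates turn a punctured disc into a half-infinite cylinder. -/
noncomputable def polar (R : ℝ) (ζ : ℂ) : ℂ := R * exp ζ

theorem polar_mem {R : ℝ} (hR : 0 < R) {ζ : ℂ} (hζ : ζ ∈ leftHalfPlane) :
    polar R ζ ∈ ball (0 : ℂ) R \ {0} := by
  refine ⟨?_, by simp [polar, hR.ne', exp_ne_zero]⟩
  rw [mem_ball_zero_iff, polar, norm_mul, norm_exp, norm_real, Real.norm_of_nonneg hR.le]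
  exact mul_lt_of_lt_one_right hR (Real.exp_lt_one_iff.2 hζ)

theorem contDiff_polar (R : ℝ) : ContDiff ℝ (⊤ : ℕ∞) (polar R) :=
  contDiff_const.mul (contDiff_exp (𝕜 := ℝ))

theorem hasFDerivAt_polar (R : ℝ) (ζ : ℂ) :
    HasFDerivAt (polar R)
      ((ContinuousLinearMap.toSpanSingleton ℂ (polar R ζ)).restrictScalars ℝ) ζ :=
  ((Complex.hasDerivAt_exp ζ).const_mul (R : ℂ)).hasFDerivAt.restrictScalars ℝ

theorem polar_log {R : ℝ} (hR : 0 < R) {z : ℂ} (hz : z ≠ 0) : polar R (log (z / R)) = z := by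
  have hR' : (R : ℂ) ≠ 0 := by exact_mod_cast hR.ne'
  rw [polar, exp_log (div_ne_zero hz hR'), mul_div_cancel₀ _ hR']

theorem log_div_re {R : ℝ} (hR : 0 < R) {z : ℂ} (hz : z ≠ 0) :
    (log (z / R)).re = Real.log ‖z‖ - Real.log R := by
  rw [log_re, norm_div, norm_real, Real.norm_of_nonneg hR.le,
    Real.log_div (norm_ne_zero_iff.2 hz) hR.ne']

variable {R : ℝ}

theorem hasFDerivAt_comp_polar (hR : 0 < R) (hu : ContDiffOn ℝ (⊤ : ℕ∞) u (ball 0 R \ {0}))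
    {ζ : ℂ} (hζ : ζ ∈ leftHalfPlane) (h : ℂ) :
    fderiv ℝ (fun ζ => u (polar R ζ)) ζ h = fderiv ℝ u (polar R ζ) (h * polar R ζ) := by
  have h1 := (hasFDerivAt_of_smooth (isOpen_ball.sdiff isClosed_singleton) hu
    (polar_mem hR hζ)).comp ζ (hasFDerivAt_polar R ζ)
  have h2 := congrArg (· h) h1.fderiv
  simpa [Function.comp_def] using h2

theorem IsHolOn.comp_polar (hJ2 : ∀ x v, J x (J x v) = -v) (hR : 0 < R)
    (hu : IsHolOn J u (ball 0 R \ {0})) :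
    IsHolOn J (fun ζ => u (polar R ζ)) leftHalfPlane := by
  refine ⟨hu.contDiffOn.comp (contDiff_polar R).contDiffOn fun ζ => polar_mem hR, fun ζ hζ => ?_⟩
  rw [hasFDerivAt_comp_polar hR hu.contDiffOn hζ, hasFDerivAt_comp_polar hR hu.contDiffOn hζ,
    hu.fderiv_I_mul hJ2 (polar_mem hR hζ), hJ2, one_mul, add_neg_cancel]

end Punctured

section Main

theorem exists_limit_of_innerProductSpace {V : Type*} [NormedAddCommGroup V]
    [InnerProductSpace ℝ V] [FiniteDimensional ℝ V]
    {J : V → V →L[ℝ] V} (hJ : ContDiff ℝ (⊤ : ℕ∞) J) (hJ2 : ∀ x v, J x (J x v) = -v)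
    {K : Set V} (hK : IsCompact K) (ω : V →L[ℝ] V →L[ℝ] ℝ) (hω : ∀ a b, ω a b = -ω b a)
    {c : ℝ} (hc : 0 < c) (htame : ∀ x ∈ K, ∀ w, c * ‖w‖ ^ 2 ≤ ω w (J x w))
    {R : ℝ} (hR : 0 < R) {u : ℂ → V} (hu : IsHolOn J u (ball 0 R \ {0}))
    (hmaps : MapsTo u (ball 0 R \ {0}) K) :
    ∃ p, Tendsto u (𝓝[≠] 0) (𝓝 p) ∧ ∃ C ρ : ℝ, 0 < ρ ∧ ρ ≤ R ∧
      ∀ z ∈ ball (0 : ℂ) ρ \ {0}, ‖fderiv ℝ u z‖ ≤ C := by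
  set v : ℂ → V := fun ζ => u (polar R ζ) with hvdef
  have hv : IsHolOn J v leftHalfPlane := hu.comp_polar hJ2 hR
  have hper : ∀ ζ, v (ζ + 2 * π * I) = v ζ := fun ζ => by
    simp only [hvdef, polar, exp_add, exp_two_pi_mul_I, mul_one]
  have hmv : MapsTo v leftHalfPlane K := fun ζ hζ => hmaps (polar_mem hR hζ)
  obtain ⟨μ, C₀, s₂, hμ, hs₂, hC₀, hdec⟩ := exists_decay hJ hJ2 hK ω hω hc htame hv hper hmv
  obtain ⟨p, hpK, C', hC', hlim⟩ := exists_limit_of_decay hJ hK hv hper hmv hμ hs₂ hC₀ hdec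
  obtain ⟨C, s₃, hs₃, hC, hsharp⟩ :=
    exists_sharp_decay hJ hJ2 hK hv hper hmv hpK (half_pos hμ) hs₂ hC' hlim
  have hlog : Tendsto (fun z : ℂ => Real.log ‖z‖ - Real.log R) (𝓝[≠] 0) atBot :=
    tendsto_atBot_add_const_right _ _ (Real.tendsto_log_nhdsGT_zero.comp tendsto_norm_nhdsNE_zero)
  refine ⟨p, ?_, ?_⟩
  · rw [tendsto_iff_norm_sub_tendsto_zero]
    have hz : Tendsto (fun z : ℂ => C' * Real.exp (μ / 2 * (Real.log ‖z‖ - Real.log R)))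
        (𝓝[≠] 0) (𝓝 0) := by
      simpa using (Real.tendsto_exp_atBot.comp
        (hlog.const_mul_atBot (half_pos hμ))).const_mul C'
    refine squeeze_zero' (Eventually.of_forall fun _ => norm_nonneg _) ?_ hz
    filter_upwards [hlog.eventually_le_atBot s₂, self_mem_nhdsWithin] with z hz hz0
    have := hlim (log (z / R)) (by rwa [log_div_re hR hz0])
    rw [log_div_re hR hz0] at this
    simpa only [hvdef, polar_log hR hz0] using this
  · obtain ⟨c₀, hc₀⟩ := hK.exists_bound_of_continuousOn hJ.continuous.continuousOn
    refine ⟨√C / R + |c₀| * (√C / R), R * Real.exp s₃, by positivity,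
      mul_le_of_le_one_right hR.le (Real.exp_le_one_iff.2 hs₃.le), fun z hz => ?_⟩
    have hz0 : z ≠ 0 := hz.2
    have hzn : 0 < ‖z‖ := norm_pos_iff.2 hz0
    set ζ := log (z / R) with hζdef
    have hζz : polar R ζ = z := polar_log hR hz0
    have hre : ζ.re = Real.log ‖z‖ - Real.log R := log_div_re hR hz0
    have hζ : ζ.re ≤ s₃ := by
      rw [hre, ← Real.log_div hzn.ne' hR.ne', Real.log_le_iff_le_exp (by positivity),
        div_le_iff₀ hR, mul_comm]
      exact (mem_ball_zero_iff.1 hz.1).le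
    have hζ' : ζ ∈ leftHalfPlane := lt_of_le_of_lt hζ hs₃
    have hzR : z ∈ ball (0 : ℂ) R \ {0} := hζz ▸ polar_mem hR hζ'
    have h1 : ‖fderiv ℝ u z (I * z)‖ ≤ √C / R * ‖z‖ := by
      have h := hsharp ζ hζ
      rw [hvdef, hasFDerivAt_comp_polar hR hu.contDiffOn hζ', hζz] at h
      have hexp : Real.exp (2 * ζ.re) = (‖z‖ / R) ^ 2 := by
        rw [hre, ← Real.log_div hzn.ne' hR.ne', two_mul, Real.exp_add,
          Real.exp_log (by positivity), sq]
      refine le_of_sq_le_sq ?_ (by positivity)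
      rw [mul_pow, div_pow, Real.sq_sqrt hC]
      refine h.trans (le_of_eq ?_)
      rw [hexp]
      ring
    have h2 : ‖fderiv ℝ u z z‖ ≤ |c₀| * (√C / R) * ‖z‖ := by
      have e : fderiv ℝ u z z = -J (u z) (fderiv ℝ u z (I * z)) := by
        rw [hu.fderiv_I_mul hJ2 hzR, hJ2, neg_neg]
      rw [e, norm_neg, mul_assoc]
      exact ((J (u z)).le_opNorm _).trans (mul_le_mul
        ((hc₀ _ (hmaps hzR)).trans (le_abs_self _)) h1 (norm_nonneg _) (abs_nonneg _))
    refine ContinuousLinearMap.opNorm_le_bound _ (by positivity) fun h => ?_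
    have e : h = (h / z).re • z + (h / z).im • (I * z) := by
      conv_lhs => rw [← div_mul_cancel₀ h hz0, ← re_add_im (h / z)]
      simp only [real_smul]
      ring
    have n : ‖h / z‖ * ‖z‖ = ‖h‖ := by rw [← norm_mul, div_mul_cancel₀ h hz0]
    rw [e, map_add, map_smul, map_smul, ← e]
    calc _ ≤ ‖h / z‖ * (|c₀| * (√C / R) * ‖z‖) + ‖h / z‖ * (√C / R * ‖z‖) := by
          refine norm_add_le_of_le ?_ ?_
          · rw [norm_smul]
            exact mul_le_mul (abs_re_le_norm _) h2 (norm_nonneg _) (norm_nonneg _)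
          · rw [norm_smul]
            exact mul_le_mul (abs_im_le_norm _) h1 (norm_nonneg _) (norm_nonneg _)
      _ = (√C / R + |c₀| * (√C / R)) * (‖h / z‖ * ‖z‖) := by ring
      _ = _ := by rw [n]

/-- A `J`-holomorphic curve on a punctured disc with values in a tamed compact set converges at the
puncture, and its derivative stays bounded. -/
theorem exists_limit {V : Type*} [NormedAddCommGroup V]
    [NormedSpace ℝ V] [FiniteDimensional ℝ V]
    {J : V → V →L[ℝ] V} (hJ : ContDiff ℝ (⊤ : ℕ∞) J) (hJ2 : ∀ x v, J x (J x v) = -v)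
    {K : Set V} (hK : IsCompact K) (ω : V →L[ℝ] V →L[ℝ] ℝ) (hω : ∀ a b, ω a b = -ω b a)
    {c : ℝ} (hc : 0 < c) (htame : ∀ x ∈ K, ∀ w, c * ‖w‖ ^ 2 ≤ ω w (J x w))
    {R : ℝ} (hR : 0 < R) {u : ℂ → V} (hu : IsHolOn J u (ball 0 R \ {0}))
    (hmaps : MapsTo u (ball 0 R \ {0}) K) :
    ∃ p, Tendsto u (𝓝[≠] 0) (𝓝 p) ∧ ∃ C ρ : ℝ, 0 < ρ ∧ ρ ≤ R ∧
      ∀ z ∈ ball (0 : ℂ) ρ \ {0}, ‖fderiv ℝ u z‖ ≤ C := by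
  set L := toEuclidean (E := V) with hL
  set J' := fun x => (L : V →L[ℝ] EuclideanSpace ℝ (Fin (Module.finrank ℝ V))).comp ((J (L.symm x)).comp (L.symm : EuclideanSpace ℝ (Fin (Module.finrank ℝ V)) →L[ℝ] V)) with hJ'
  have hJ's : ContDiff ℝ (⊤ : ℕ∞) J' :=
    contDiff_const.clm_comp ((hJ.comp L.symm.contDiff).clm_comp contDiff_const)
  have hΩ : IsOpen (ball (0 : ℂ) R \ {0}) := isOpen_ball.sdiff isClosed_singleton
  have hd : ∀ z ∈ ball (0 : ℂ) R \ {0}, fderiv ℝ (fun z => L (u z)) z =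
      (L : V →L[ℝ] EuclideanSpace ℝ (Fin (Module.finrank ℝ V))).comp (fderiv ℝ u z) := fun z hz =>
    (L.hasFDerivAt.comp z (hasFDerivAt_of_smooth hΩ hu.contDiffOn hz)).fderiv
  set N := ‖(L : V →L[ℝ] EuclideanSpace ℝ (Fin (Module.finrank ℝ V)))‖ + 1 with hN
  have hNpos : 0 < N := by positivity
  have hLle : ∀ w, ‖w‖ ≤ N * ‖L.symm w‖ := fun w => by
    have h1 := (L : V →L[ℝ] EuclideanSpace ℝ (Fin (Module.finrank ℝ V))).le_opNorm (L.symm w)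
    simp only [ContinuousLinearEquiv.coe_coe, ContinuousLinearEquiv.apply_symm_apply] at h1
    exact h1.trans (by gcongr; simp [hN])
  set ω' := ω.bilinearComp (L.symm : EuclideanSpace ℝ (Fin (Module.finrank ℝ V)) →L[ℝ] V) (L.symm : EuclideanSpace ℝ (Fin (Module.finrank ℝ V)) →L[ℝ] V) with hω'
  obtain ⟨p, hp, C, ρ, hρ, hρR, hC⟩ := exists_limit_of_innerProductSpace (J := J') hJ's
    (fun x v => by simp [hJ', hJ2]) (K := L '' K) (hK.image L.continuous) ω'
    (fun a b => by simpa [hω'] using hω _ _) (c := c / N ^ 2) (by positivity)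
    (by
      rintro _ ⟨x, hx, rfl⟩ w
      have h1 := htame x hx (L.symm w)
      have h2 : ‖w‖ ^ 2 ≤ N ^ 2 * ‖L.symm w‖ ^ 2 := by
        rw [← mul_pow]; exact pow_le_pow_left₀ (norm_nonneg _) (hLle w) 2
      simp only [hω', hJ', ContinuousLinearMap.bilinearComp_apply,
        ContinuousLinearMap.comp_apply, ContinuousLinearEquiv.coe_coe,
        ContinuousLinearEquiv.symm_apply_apply]
      refine le_trans ?_ h1
      rw [div_mul_eq_mul_div, div_le_iff₀ (by positivity)]
      calc c * ‖w‖ ^ 2 ≤ c * (N ^ 2 * ‖L.symm w‖ ^ 2) := by gcongr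
        _ = _ := by ring)
    hR (u := fun z => L (u z))
    ⟨L.contDiff.comp_contDiffOn hu.contDiffOn, fun z hz => by
      rw [hd z hz]
      have := congrArg L (hu.cauchyRiemann z hz)
      simpa [hJ'] using this⟩
    (fun z hz => mem_image_of_mem _ (hmaps hz))
  refine ⟨L.symm p, ?_, ‖(L.symm : EuclideanSpace ℝ (Fin (Module.finrank ℝ V)) →L[ℝ] V)‖ * C, ρ, hρ, hρR, fun z hz => ?_⟩
  · have := (L.symm.continuous.tendsto p).comp hp
    simpa [Function.comp_def] using this
  · have hzR : z ∈ ball (0 : ℂ) R \ {0} := ⟨ball_subset_ball hρR hz.1, hz.2⟩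
    have e : fderiv ℝ u z = (L.symm : EuclideanSpace ℝ (Fin (Module.finrank ℝ V)) →L[ℝ] V).comp (fderiv ℝ (fun z => L (u z)) z) := by
      rw [hd z hzR]; ext; simp
    rw [e]
    refine (ContinuousLinearMap.opNorm_comp_le _ _).trans ?_
    gcongr
    exact hC z hz

end Main

section Removable

/-- If `f` is continuous at `0`, differentiable off `0`, and its derivative extends continuously
over `0`, then it is differentiable at `0`. -/
theorem hasFDerivAt_zero_of_continuousAt {E F : Type*} [NormedAddCommGroup E] [NormedSpace ℝ E]
    [NormedAddCommGroup F] [NormedSpace ℝ F] {f : E → F} {D : E → E →L[ℝ] F}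
    (hf : ContinuousAt f 0) (hD : ContinuousAt D 0)
    (hd : ∀ᶠ z in 𝓝[≠] 0, HasFDerivAt f (D z) z) : HasFDerivAt f (D 0) 0 := by
  rw [hasFDerivAt_iff_isLittleO_nhds_zero, Asymptotics.isLittleO_iff]
  intro ε hε
  have h1 : ∀ᶠ z in 𝓝 (0 : E), ‖D z - D 0‖ ≤ ε := by
    filter_upwards [hD (closedBall_mem_nhds _ hε)] with z hz using mem_closedBall_iff_norm.1 hz
  rw [eventually_nhdsWithin_iff] at hd
  obtain ⟨δ, hδ, hball⟩ := Metric.eventually_nhds_iff_ball.1 (h1.and hd)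
  filter_upwards [ball_mem_nhds (0 : E) hδ] with z hz
  rcases eq_or_ne z 0 with rfl | hz0
  · simp
  rw [zero_add]
  set g : ℝ → F := fun t => f (t • z) - D 0 (t • z) with hg
  have hmem : ∀ t ∈ Icc (0 : ℝ) 1, t • z ∈ ball (0 : E) δ := fun t ht => by
    rw [mem_ball_zero_iff, norm_smul, Real.norm_of_nonneg ht.1]
    exact (mul_le_of_le_one_left (norm_nonneg _) ht.2).trans_lt (mem_ball_zero_iff.1 hz)
  have hgd : ∀ t : ℝ, 0 < t → t ≤ 1 → HasDerivAt g ((D (t • z) - D 0) z) t := by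
    intro t ht0 ht1
    have hl : HasDerivAt (fun t : ℝ => t • z) z t := by
      simpa using (hasDerivAt_id t).smul_const z
    exact (((hball _ (hmem t ⟨ht0.le, ht1⟩)).2 (smul_ne_zero ht0.ne' hz0)).comp_hasDerivAt t hl).sub
      ((D 0).hasFDerivAt.comp_hasDerivAt t hl)
  have hbound : ∀ t : ℝ, 0 < t → t ≤ 1 → ‖g 1 - g t‖ ≤ ε * ‖z‖ := by
    intro t ht0 ht1
    have := (convex_Icc t 1).norm_image_sub_le_of_norm_hasDerivWithin_le
      (C := ε * ‖z‖) (fun x hx => (hgd x (ht0.trans_le hx.1) hx.2).hasDerivWithinAt)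
      (fun x hx => ContinuousLinearMap.le_of_opNorm_le _
        (hball _ (hmem x ⟨ht0.le.trans hx.1, hx.2⟩)).1 _)
      (left_mem_Icc.2 ht1) (right_mem_Icc.2 ht1)
    refine this.trans (mul_le_of_le_one_right (by positivity) ?_)
    rw [Real.norm_of_nonneg (by linarith)]
    linarith
  have hg0 : ContinuousAt g 0 := by
    have hl : ContinuousAt (fun t : ℝ => t • z) 0 := by fun_prop
    refine ContinuousAt.sub (ContinuousAt.comp (by simpa using hf) hl) ?_
    fun_prop
  have hlim : Tendsto (fun t => ‖g 1 - g t‖) (𝓝[>] 0) (𝓝 ‖g 1 - g 0‖) :=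
    (tendsto_const_nhds.sub (hg0.tendsto.mono_left nhdsWithin_le_nhds)).norm
  have := le_of_tendsto hlim (by
    filter_upwards [Ioc_mem_nhdsGT (zero_lt_one' ℝ)] with t ht using hbound t ht.1 ht.2)
  refine le_trans (le_of_eq ?_) this
  congr 1
  simp only [hg, one_smul, zero_smul, map_zero, sub_zero]
  abel

variable {V : Type*} [NormedAddCommGroup V] [NormedSpace ℝ V]

/-- The complete lift of a tamed almost complex structure is tamed on compact sets. -/
theorem exists_tame_lift {J : V → V →L[ℝ] V} (hJ : ContDiff ℝ (⊤ : ℕ∞) J) {K : Set V}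
    (hK : IsCompact K) (ω : V →L[ℝ] V →L[ℝ] ℝ) (hω : ∀ a b, ω a b = -ω b a) {c : ℝ} (hc : 0 < c)
    (htame : ∀ x ∈ K, ∀ w, c * ‖w‖ ^ 2 ≤ ω w (J x w)) (C : ℝ) :
    ∃ ω' : V × V →L[ℝ] V × V →L[ℝ] ℝ, (∀ a b, ω' a b = -ω' b a) ∧
      ∀ x ∈ K ×ˢ closedBall 0 C, ∀ w, c / 2 * ‖w‖ ^ 2 ≤ ω' w (lift J x w) := by
  obtain ⟨c₁, hc₁⟩ :=
    hK.exists_bound_of_continuousOn (hJ.continuous_fderiv (by simp)).continuousOn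
  set m := ‖ω‖ * (max 0 c₁ * |C|) with hm
  have hm0 : 0 ≤ m := by positivity
  set Λ := 1 + m ^ 2 / c ^ 2 with hΛ
  refine ⟨Λ • ω.bilinearComp (.fst ℝ V V) (.fst ℝ V V) + ω.bilinearComp (.snd ℝ V V) (.snd ℝ V V),
    fun a b => ?_, ?_⟩
  · simp only [_root_.add_apply, _root_.smul_apply, ContinuousLinearMap.bilinearComp_apply,
      ContinuousLinearMap.coe_fst', ContinuousLinearMap.coe_snd', smul_eq_mul]
    rw [hω a.1, hω a.2]
    ring
  · rintro ⟨x, ξ⟩ ⟨hx, hξ⟩ ⟨a, b⟩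
    simp only [_root_.add_apply, _root_.smul_apply, ContinuousLinearMap.bilinearComp_apply,
      ContinuousLinearMap.coe_fst', ContinuousLinearMap.coe_snd', smul_eq_mul, lift_apply, map_add]
    have h1 := htame x hx a
    have h2 := htame x hx b
    have h3 : |ω b (fderiv ℝ J x ξ a)| ≤ m * (‖a‖ * ‖b‖) := by
      have hξ' : ‖ξ‖ ≤ |C| := (mem_closedBall_zero_iff.1 hξ).trans (le_abs_self _)
      calc |ω b (fderiv ℝ J x ξ a)| ≤ ‖ω‖ * ‖b‖ * (max 0 c₁ * |C| * ‖a‖) := by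
            refine (ω.le_opNorm₂ _ _).trans ?_
            gcongr
            refine ContinuousLinearMap.le_of_opNorm_le _ ?_ _
            refine (ContinuousLinearMap.le_of_opNorm_le _
              ((hc₁ x hx).trans (le_max_right 0 c₁)) _).trans ?_
            gcongr
        _ = _ := by rw [hm]; ring
    have h4 := (abs_le.1 h3).1
    have h5 : m * (‖a‖ * ‖b‖) ≤ c / 2 * ‖b‖ ^ 2 + m ^ 2 / (2 * c) * ‖a‖ ^ 2 := by
      have : c / 2 * ‖b‖ ^ 2 + m ^ 2 / (2 * c) * ‖a‖ ^ 2 - m * (‖a‖ * ‖b‖) =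
          (c * ‖b‖ - m * ‖a‖) ^ 2 / (2 * c) := by
        field_simp
        ring
      have h0 : 0 ≤ (c * ‖b‖ - m * ‖a‖) ^ 2 / (2 * c) := by positivity
      linarith
    have h6 : c * ‖a‖ ^ 2 + m ^ 2 / (2 * c) * ‖a‖ ^ 2 ≤ Λ * ω a (J x a) := by
      have h7 : 0 < Λ := by positivity
      refine le_trans ?_ (mul_le_mul_of_nonneg_left h1 h7.le)
      have : Λ * (c * ‖a‖ ^ 2) - (c * ‖a‖ ^ 2 + m ^ 2 / (2 * c) * ‖a‖ ^ 2) =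
          m ^ 2 / (2 * c) * ‖a‖ ^ 2 := by
        rw [hΛ]
        field_simp
        ring
      have h0 : 0 ≤ m ^ 2 / (2 * c) * ‖a‖ ^ 2 := by positivity
      linarith
    have h8 : ‖(a, b)‖ ^ 2 ≤ ‖a‖ ^ 2 + ‖b‖ ^ 2 := by
      rw [Prod.norm_mk]
      rcases max_choice ‖a‖ ‖b‖ with h | h <;> rw [h] <;> nlinarith [sq_nonneg ‖a‖, sq_nonneg ‖b‖]
    have h9 : c / 2 * ‖(a, b)‖ ^ 2 ≤ c / 2 * (‖a‖ ^ 2 + ‖b‖ ^ 2) := by gcongr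
    nlinarith [mul_nonneg hc.le (sq_nonneg ‖a‖)]

theorem exists_tame_const [FiniteDimensional ℝ V] {J : V → V →L[ℝ] V} (hJ : Continuous J)
    {K : Set V} (hK : IsCompact K) (ω : V →L[ℝ] V →L[ℝ] ℝ)
    (htame : ∀ x ∈ K, ∀ w, w ≠ 0 → 0 < ω w (J x w)) :
    ∃ c : ℝ, 0 < c ∧ ∀ x ∈ K, ∀ w, c * ‖w‖ ^ 2 ≤ ω w (J x w) := by
  have hcont : Continuous fun p : V × V => ω p.2 (J p.1 p.2) := by fun_prop
  obtain ⟨c, hc, h⟩ := (hK.prod (isCompact_sphere (0 : V) 1)).exists_forall_le'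
    hcont.continuousOn (a := 0)
    (fun p hp => htame p.1 hp.1 p.2 (ne_zero_of_mem_unit_sphere ⟨p.2, hp.2⟩))
  refine ⟨c, hc, fun x hx w => ?_⟩
  rcases eq_or_ne w 0 with rfl | hw
  · simp
  have hn : ‖w‖ ≠ 0 := norm_ne_zero_iff.2 hw
  have h1 := h (x, ‖w‖⁻¹ • w) ⟨hx, by simp [norm_smul, hn]⟩
  simp only [map_smul, _root_.smul_apply, smul_eq_mul] at h1
  calc c * ‖w‖ ^ 2 ≤ ‖w‖⁻¹ * (‖w‖⁻¹ * ω w (J x w)) * ‖w‖ ^ 2 := by gcongr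
    _ = _ := by field_simp

end Removable

section Bootstrap

universe w

/-- All finite orders of differentiability at the puncture. -/
theorem exists_contDiffAt_update (k : ℕ) : ∀ {V : Type w} [NormedAddCommGroup V] [NormedSpace ℝ V]
    [FiniteDimensional ℝ V] {J : V → V →L[ℝ] V} (_ : ContDiff ℝ (⊤ : ℕ∞) J)
    (_ : ∀ x v, J x (J x v) = -v) {K : Set V} (_ : IsCompact K) (ω : V →L[ℝ] V →L[ℝ] ℝ)
    (_ : ∀ a b, ω a b = -ω b a) {c : ℝ} (_ : 0 < c)
    (_ : ∀ x ∈ K, ∀ w, c * ‖w‖ ^ 2 ≤ ω w (J x w))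
    {R : ℝ} (_ : 0 < R) {u : ℂ → V} (_ : IsHolOn J u (ball 0 R \ {0}))
    (_ : MapsTo u (ball 0 R \ {0}) K), ∃ p, ContDiffAt ℝ k (Function.update u 0 p) 0 := by
  induction k with
  | zero =>
    intro V _ _ _ J hJ hJ2 K hK ω hω c hc htame R hR u hu hmaps
    obtain ⟨p, hp, -⟩ := exists_limit hJ hJ2 hK ω hω hc htame hR hu hmaps
    refine ⟨p, ?_⟩
    have hca : ContinuousAt (Function.update u 0 p) 0 := continuousAt_update_same.2 hp
    rw [CharP.cast_eq_zero, contDiffAt_zero]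
    refine ⟨ball 0 R, ball_mem_nhds _ hR, fun z hz => ?_⟩
    rcases eq_or_ne z 0 with rfl | hz0
    · exact hca.continuousWithinAt
    · have hΩ : IsOpen (ball (0 : ℂ) R \ {0}) := isOpen_ball.sdiff isClosed_singleton
      have := hu.contDiffOn.continuousOn.continuousAt (hΩ.mem_nhds ⟨hz, hz0⟩)
      exact (continuousAt_update_of_ne hz0).2 this |>.continuousWithinAt
  | succ k ih =>
    intro V _ _ _ J hJ hJ2 K hK ω hω c hc htame R hR u hu hmaps
    obtain ⟨-, -, C, ρ, hρ, hρR, hC⟩ := exists_limit hJ hJ2 hK ω hω hc htame hR hu hmaps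
    have hΩ : IsOpen (ball (0 : ℂ) ρ \ {0}) := isOpen_ball.sdiff isClosed_singleton
    have hsub : ball (0 : ℂ) ρ \ {0} ⊆ ball 0 R \ {0} :=
      sdiff_subset_sdiff_left (ball_subset_ball hρR)
    have hu' : IsHolOn J u (ball 0 ρ \ {0}) :=
      ⟨hu.contDiffOn.mono hsub, fun z hz => hu.cauchyRiemann z (hsub hz)⟩
    obtain ⟨ω', hω', htame'⟩ := exists_tame_lift hJ hK ω hω hc htame C
    obtain ⟨q, hq⟩ := ih (contDiff_lift hJ) (lift_sq hJ hJ2) (hK.prod (isCompact_closedBall 0 C))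
      ω' hω' (half_pos hc) htame' hρ (hu'.lift hΩ hJ) (fun z hz => ⟨hmaps (hsub hz), by
        rw [mem_closedBall_zero_iff]
        simpa using (fderiv ℝ u z).le_of_opNorm_le (hC z hz) I⟩)
    set F := Function.update (fun z => (u z, fderiv ℝ u z I)) 0 q with hF
    have hF1 : (fun z => (F z).1) = Function.update u 0 q.1 := by
      ext z
      rcases eq_or_ne z 0 with rfl | hz0
      · simp [hF]
      · simp [hF, hz0]
    set D : ℂ → ℂ →L[ℝ] V := fun z =>
      reCLM.smulRight (-(J (F z).1 (F z).2)) + imCLM.smulRight (F z).2 with hDdef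
    have hFc1 : ContDiffAt ℝ k (fun z => (F z).1) 0 := contDiffAt_fst.comp 0 hq
    have hFc2 : ContDiffAt ℝ k (fun z => (F z).2) 0 := contDiffAt_snd.comp 0 hq
    have hJk : ContDiff ℝ k J := hJ.of_le (by exact_mod_cast le_top)
    have hDk : ContDiffAt ℝ k D 0 :=
      (contDiffAt_const.smulRight ((hJk.contDiffAt.comp 0 hFc1).clm_apply hFc2).neg).add
        (contDiffAt_const.smulRight hFc2)
    have hoff : ∀ z ∈ ball (0 : ℂ) ρ \ {0}, HasFDerivAt (fun z => (F z).1) (D z) z := by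
      intro z hz
      have hz0 : z ≠ 0 := hz.2
      have heq : (fun z => (F z).1) =ᶠ[𝓝 z] u := by
        filter_upwards [isOpen_ne.mem_nhds hz0] with y hy
        simp [hF, hy]
      refine HasFDerivAt.congr_of_eventuallyEq ?_ heq
      convert! hasFDerivAt_of_smooth hΩ hu'.contDiffOn hz using 1
      ext h
      have e : h = h.re • (1 : ℂ) + h.im • I := by apply Complex.ext <;> simp
      conv_rhs => rw [e, map_add, map_smul, map_smul, hu'.fderiv_one hz]
      simp [hDdef, hF, hz0]
    have h0 : HasFDerivAt (fun z => (F z).1) (D 0) 0 := by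
      refine hasFDerivAt_zero_of_continuousAt hFc1.continuousAt hDk.continuousAt ?_
      rw [eventually_nhdsWithin_iff]
      filter_upwards [ball_mem_nhds (0 : ℂ) hρ] with z hz hz0 using hoff z ⟨hz, hz0⟩
    refine ⟨q.1, ?_⟩
    rw [← hF1]
    push_cast
    rw [contDiffAt_succ_iff_hasFDerivAt]
    refine ⟨D, ⟨ball 0 ρ, ball_mem_nhds _ hρ, fun z hz => ?_⟩, hDk⟩
    rcases eq_or_ne z 0 with rfl | hz0
    · exact h0
    · exact hoff z ⟨hz, hz0⟩

/-- Removal of singularities for bounded `J`-holomorphic curves in a tamed vector space. -/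
theorem exists_extension {V : Type*} [NormedAddCommGroup V] [NormedSpace ℝ V]
    [FiniteDimensional ℝ V] {J : V → V →L[ℝ] V} (hJ : ContDiff ℝ (⊤ : ℕ∞) J)
    (hJ2 : ∀ x v, J x (J x v) = -v) {K : Set V} (hK : IsCompact K) (ω : V →L[ℝ] V →L[ℝ] ℝ)
    (hω : ∀ a b, ω a b = -ω b a) (htame : ∀ x ∈ K, ∀ w, w ≠ 0 → 0 < ω w (J x w))
    {R : ℝ} (hR : 0 < R) {u : ℂ → V} (hu : IsHolOn J u (ball 0 R \ {0}))
    (hmaps : MapsTo u (ball 0 R \ {0}) K) :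
    ∃ v, IsHolOn J v (ball 0 R) ∧ ∀ z ∈ ball (0 : ℂ) R \ {0}, v z = u z := by
  obtain ⟨c, hc, hc'⟩ := exists_tame_const hJ.continuous hK ω htame
  have hk := fun k => exists_contDiffAt_update k hJ hJ2 hK ω hω hc hc' hR hu hmaps
  obtain ⟨p, hp, -⟩ := exists_limit hJ hJ2 hK ω hω hc hc' hR hu hmaps
  set v := Function.update u 0 p with hv
  have hΩ : IsOpen (ball (0 : ℂ) R \ {0}) := isOpen_ball.sdiff isClosed_singleton
  have h0 : ContDiffAt ℝ (⊤ : ℕ∞) v 0 := by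
    rw [contDiffAt_infty]
    intro k
    obtain ⟨q, hq⟩ := hk k
    rwa [hv, tendsto_nhds_unique hp (continuousAt_update_same.1 hq.continuousAt)]
  have heq : ∀ z : ℂ, z ≠ 0 → v =ᶠ[𝓝 z] u := fun z hz => by
    filter_upwards [isOpen_ne.mem_nhds hz] with y hy
    simp [hv, hy]
  have hsm : ContDiffOn ℝ (⊤ : ℕ∞) v (ball 0 R) := by
    intro z hz
    rcases eq_or_ne z 0 with rfl | hz0
    · exact h0.contDiffWithinAt
    · exact ((hu.contDiffOn.contDiffAt (hΩ.mem_nhds ⟨hz, hz0⟩)).congr_of_eventuallyEq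
        (heq z hz0)).contDiffWithinAt
  have hCR : ∀ z ∈ ball (0 : ℂ) R \ {0}, fderiv ℝ v z 1 + J (v z) (fderiv ℝ v z I) = 0 := by
    intro z hz
    rw [(heq z hz.2).fderiv_eq, (heq z hz.2).eq_of_nhds]
    exact hu.cauchyRiemann z hz
  refine ⟨v, ⟨hsm, fun z hz => ?_⟩, fun z hz => (heq z hz.2).eq_of_nhds⟩
  rcases eq_or_ne z 0 with rfl | hz0
  · have hcont : ContinuousOn (fun z => fderiv ℝ v z 1 + J (v z) (fderiv ℝ v z I)) (ball 0 R) :=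
      (contDiffOn_fderiv_apply isOpen_ball hsm 1).continuousOn.add
        ((hJ.continuous.comp_continuousOn hsm.continuousOn).clm_apply
          (contDiffOn_fderiv_apply isOpen_ball hsm I).continuousOn)
    have h1 := (hcont.continuousAt (ball_mem_nhds _ hR)).tendsto.mono_left
      (nhdsWithin_le_nhds (s := {0}ᶜ))
    refine tendsto_nhds_unique h1 (tendsto_const_nhds.congr' ?_)
    rw [EventuallyEq, eventually_nhdsWithin_iff]
    filter_upwards [ball_mem_nhds (0 : ℂ) hR] with z hz hz0 using (hCR z ⟨hz, hz0⟩).symm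
  · exact hCR z ⟨hz, hz0⟩

end Bootstrap

end PseudoHol

/-- **Gromov's removable singularity theorem** (local version in `ℂⁿ`).
Let `ω` be a nondegenerate alternating real bilinear form on `ℂⁿ`, `J` an almost
complex structure on `ℂⁿ` tamed by `ω`, and `u : B \ {0} → ℂⁿ` a smooth
`J`-holomorphic curve with image in a compact set and finite energy
`∫_{B\{0}} ω(∂ₛu, ∂ₜu) < ∞`.  Then `u` extends smoothly over `0` to a
`J`-holomorphic curve on `B`. -/
theorem gromov_removable_singularity (n : ℕ)
    (ω : EuclideanSpace ℂ (Fin n) →ₗ[ℝ] EuclideanSpace ℂ (Fin n) →ₗ[ℝ] ℝ)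
    (halt : ∀ v, ω v v = 0)
    (hnondeg : ∀ v, (∀ w, ω v w = 0) → v = 0)
    (J : EuclideanSpace ℂ (Fin n) →
      (EuclideanSpace ℂ (Fin n) →L[ℝ] EuclideanSpace ℂ (Fin n)))
    (hJsmooth : ContDiff ℝ (⊤ : ℕ∞) J)
    (hJsq : ∀ x v, J x (J x v) = -v)
    (htame : ∀ x, ∀ v, v ≠ 0 → 0 < ω v (J x v))
    (u : ℂ → EuclideanSpace ℂ (Fin n))
    (husmooth : ContDiffOn ℝ (⊤ : ℕ∞) u (ball 0 1 \ {0}))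
    (huCR : ∀ z ∈ ball (0 : ℂ) 1 \ {0},
      fderiv ℝ u z 1 + J (u z) (fderiv ℝ u z Complex.I) = 0)
    (hcompact : ∃ K : Set (EuclideanSpace ℂ (Fin n)), IsCompact K ∧
      Set.MapsTo u (ball 0 1 \ {0}) K)
    (henergy : ∫⁻ z in ball (0 : ℂ) 1 \ {0},
      ENNReal.ofReal (ω (fderiv ℝ u z 1) (fderiv ℝ u z Complex.I)) < ⊤) :
    ∃ v : ℂ → EuclideanSpace ℂ (Fin n),
      ContDiffOn ℝ (⊤ : ℕ∞) v (ball 0 1) ∧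
      (∀ z ∈ ball (0 : ℂ) 1,
        fderiv ℝ v z 1 + J (v z) (fderiv ℝ v z Complex.I) = 0) ∧
      (∀ z ∈ ball (0 : ℂ) 1 \ {0}, v z = u z) := by
  obtain ⟨K, hK, hmaps⟩ := hcompact
  have hskew (a b) : ω a b = -ω b a := by
    have h := halt (a + b)
    simp only [map_add, LinearMap.add_apply, halt] at h
    linarith
  obtain ⟨v, hv, hvu⟩ := PseudoHol.exists_extension hJsmooth hJsq hK ω.toContinuousBilinearMap
    hskew (fun x _ w hw => htame x w hw) one_pos ⟨husmooth, huCR⟩ hmaps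
  exact ⟨v, hv.contDiffOn, hv.cauchyRiemann, hvu⟩
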